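/- arXiv:1203.3255 — 3 statements merged into one kernel-verified Lean document; each statement's English description precedes it below -/
import Mathlib

section
/- Fix a final time T > 0 and an initial condition x₀ = (S₀, L1₀, I₀, L2₀, R₀) ∈ ℝ⁵ with all entries nonnegative and summing to N. Then there exists an admissible control pair (u1*, u2*) on [0,T] together with an associated trajectory x* = (S*, L1*, I*, L2*, R*) (a continuous function on [0,T] satisfying the integral form x*(t) = x₀ + ∫₀ᵗ F(x*(s), u1*(s), u2*(s)) ds, where F is the right-hand side of the TB control system) such that for every admissible control pair (u1, u2) with associated trajectory x on [0,T] starting from x₀, one has J(u1*, u2*) ≤ J(u1, u2); i.e., the optimal control problem of minimizing J over admissible pairs admits a solution. -/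
/-- The right-hand side of the TB control system, as a function of the state
`x = (S, L₁, I, L₂, R) ∈ ℝ⁵` and the control values `u₁, u₂`. -/
noncomputable def tbRHS (μ β δ ω ωR σ σR τ0 τ1 τ2 N ε1 ε2 φ : ℝ)
    (x : Fin 5 → ℝ) (u1 u2 : ℝ) : Fin 5 → ℝ :=
  ![μ * N - β / N * x 2 * x 0 - μ * x 0,
    β / N * x 2 * (x 0 + σ * x 3 + σR * x 4) - (δ + τ1 + μ) * x 1,
    φ * δ * x 1 + ω * x 3 + ωR * x 4 - (τ0 + ε1 * u1 + μ) * x 2,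
    (1 - φ) * δ * x 1 - σ * (β / N) * x 2 * x 3 - (ω + ε2 * u2 + τ2 + μ) * x 3,
    (τ0 + ε1 * u1) * x 2 + τ1 * x 1 + (τ2 + ε2 * u2) * x 3
      - σR * (β / N) * x 2 * x 4 - (ωR + μ) * x 4]

/-- An admissible control pair on `[0,T]`: measurable (hence, having values in
`[0,1]`, essentially bounded) functions with values in `[0,1]`. -/
def IsAdmissible (T : ℝ) (u1 u2 : ℝ → ℝ) : Prop :=
  Measurable u1 ∧ Measurable u2 ∧
    ∀ t ∈ Set.Icc (0 : ℝ) T, u1 t ∈ Set.Icc (0 : ℝ) 1 ∧ u2 t ∈ Set.Icc (0 : ℝ) 1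

/-- A trajectory of the TB control system on `[0,T]` associated with the control
pair `(u1, u2)` and issuing from `x₀`: a continuous function satisfying the
integral form of the ODE. -/
noncomputable def IsTrajectory (μ β δ ω ωR σ σR τ0 τ1 τ2 N ε1 ε2 φ : ℝ)
    (T : ℝ) (x₀ : Fin 5 → ℝ) (u1 u2 : ℝ → ℝ) (x : ℝ → Fin 5 → ℝ) : Prop :=
  ContinuousOn x (Set.Icc (0 : ℝ) T) ∧
    ∀ t ∈ Set.Icc (0 : ℝ) T,
      x t = x₀ + ∫ s in (0 : ℝ)..t, tbRHS μ β δ ω ωR σ σR τ0 τ1 τ2 N ε1 ε2 φ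
        (x s) (u1 s) (u2 s)

/-- The cost functional `J` of a control pair with associated trajectory `x`
(the state components `I` and `L₂` are `x · 2` and `x · 3`). -/
noncomputable def tbCost (W1 W2 T : ℝ) (u1 u2 : ℝ → ℝ) (x : ℝ → Fin 5 → ℝ) : ℝ :=
  ∫ t in (0 : ℝ)..T, (x t 2 + x t 3 + W1 / 2 * u1 t ^ 2 + W2 / 2 * u2 t ^ 2)

open Set Filter Topology MeasureTheory

theorem tb_gronwall {T L : ℝ} (hT : 0 ≤ T) (hL : 0 ≤ L) {f e : ℝ → ℝ} (hf : Continuous f)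
    (he : Continuous e) (he0 : ∀ t, 0 ≤ e t)
    (h : ∀ t ∈ Icc 0 T, f t ≤ L * (∫ s in (0:ℝ)..t, f s) + e t) :
    ∫ s in (0:ℝ)..T, f s ≤ Real.exp (L * T) * ∫ s in (0:ℝ)..T, e s := by
  have hd : ∀ t, HasDerivAt (fun t => (∫ s in (0:ℝ)..t, e s) -
      Real.exp (-(L * t)) * ∫ s in (0:ℝ)..t, f s)
      (e t - (Real.exp (-(L * t)) * (-(L * 1)) * (∫ s in (0:ℝ)..t, f s)
        + Real.exp (-(L * t)) * f t)) t := by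
    intro t
    have h1 := intervalIntegral.integral_hasDerivAt_right (he.intervalIntegrable 0 t)
      (he.stronglyMeasurableAtFilter _ _) he.continuousAt
    have h2 := intervalIntegral.integral_hasDerivAt_right (hf.intervalIntegrable 0 t)
      (hf.stronglyMeasurableAtFilter _ _) hf.continuousAt
    have h3 := (((hasDerivAt_id t).const_mul L).neg).exp
    exact h1.sub (h3.mul h2)
  have hm := monotoneOn_of_deriv_nonneg (convex_Icc (0:ℝ) T)
    (fun t _ => (hd t).continuousAt.continuousWithinAt)
    (fun t _ => (hd t).differentiableAt.differentiableWithinAt)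
    (fun t ht => by
      rw [interior_Icc] at ht
      rw [(hd t).deriv]
      have h1 := h t ⟨ht.1.le, ht.2.le⟩
      have h2 : Real.exp (-(L * t)) ≤ 1 := by
        rw [Real.exp_le_one_iff]
        have := mul_nonneg hL ht.1.le
        linarith
      have h3 := Real.exp_pos (-(L * t))
      have h4 := he0 t
      nlinarith [mul_le_mul_of_nonneg_left h1 h3.le, mul_le_mul_of_nonneg_right h2 h4])
  have := hm (left_mem_Icc.2 hT) (right_mem_Icc.2 hT) hT
  simp only [intervalIntegral.integral_same, mul_zero, sub_zero] at this
  have h5 := mul_le_mul_of_nonneg_left this (Real.exp_pos (L * T)).le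
  have h6 : Real.exp (L*T) * Real.exp (-(L * T)) = 1 := by
    rw [← Real.exp_add]; simp
  rw [mul_zero, mul_sub, ← mul_assoc, h6, one_mul] at h5
  linarith

theorem tb_pos {T : ℝ} {f a : ℝ → ℝ} {c : ℝ} (hc : 0 ≤ c) (hf : Continuous f)
    (ha : ∀ t ∈ Icc 0 T, IntervalIntegrable a volume 0 t)
    (h : ∀ t ∈ Icc 0 T, f t = c + ∫ s in (0:ℝ)..t, a s)
    (hn : ∀ t ∈ Icc 0 T, f t < 0 → 0 ≤ a t) : ∀ t ∈ Icc 0 T, 0 ≤ f t := by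
  intro t ht
  by_contra! hlt
  have h0 : (0:ℝ) ∈ {s ∈ Icc 0 t | 0 ≤ f s} := by
    refine ⟨⟨le_rfl, ht.1⟩, ?_⟩
    rw [h 0 ⟨le_rfl, ht.1.trans ht.2⟩]; simpa using hc
  have hcl : IsCompact {s ∈ Icc 0 t | 0 ≤ f s} := by
    have : {s ∈ Icc 0 t | 0 ≤ f s} = Icc 0 t ∩ {s | 0 ≤ f s} := rfl
    rw [this]
    exact isCompact_Icc.inter_right (isClosed_le continuous_const hf)
  obtain ⟨r, ⟨hr, hr0⟩, hmax⟩ := hcl.exists_isGreatest ⟨0, h0⟩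
  have hrT : r ∈ Icc 0 T := ⟨hr.1, hr.2.trans ht.2⟩
  have h1 := h t ht
  have h2 := h r hrT
  have h3 := intervalIntegral.integral_interval_sub_left (ha t ht) (ha r hrT)
  have h4 : 0 ≤ ∫ s in r..t, a s := by
    have : ∫ s in r..t, a s = ∫ s in Ioc r t, a s := intervalIntegral.integral_of_le hr.2
    rw [this]
    refine setIntegral_nonneg measurableSet_Ioc fun s hs => ?_
    apply hn s ⟨hr.1.trans hs.1.le, hs.2.trans ht.2⟩
    by_contra! hge
    exact absurd (hmax ⟨⟨hr.1.trans hs.1.le, hs.2⟩, hge⟩) (not_le.2 hs.1)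
  linarith

theorem tb_exists {E : Type*} [NormedAddCommGroup E] [NormedSpace ℝ E] [CompleteSpace E]
    {T L M : ℝ} (hT : 0 ≤ T) (hL : 0 ≤ L) (H : ℝ → E → E)
    (hm : ∀ w : ℝ → E, Continuous w → AEStronglyMeasurable (fun s => H s (w s)) volume)
    (hb : ∀ s v, ‖H s v‖ ≤ M) (hl : ∀ s v w, ‖H s v - H s w‖ ≤ L * ‖v - w‖) (x₀ : E) :
    ∃ x : ℝ → E, Continuous x ∧ ∀ t ∈ Icc 0 T, x t = x₀ + ∫ s in (0:ℝ)..t, H s (x s) := by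
  have hI : ∀ w : ℝ → E, Continuous w → ∀ a b, 
      IntervalIntegrable (fun s => H s (w s)) volume a b := by
    intro w hw a b
    exact (intervalIntegrable_const (c := M)).mono_fun (hm w hw).restrict
      (Eventually.of_forall fun s => (hb _ _).trans (le_abs_self M))
  set K : ℝ := 2 * (L + 1) with hK
  have hKpos : 0 < K := by positivity
  let c : ℝ → ℝ := fun t => max 0 (min t T)
  have hc : Continuous c := by fun_prop
  have hc0 : ∀ t, 0 ≤ c t := fun t => le_max_left _ _
  have hcT : ∀ t, c t ≤ T := fun t => max_le hT (min_le_right _ _)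
  have hM : 0 ≤ M := (norm_nonneg _).trans (hb 0 0)
  let w : BoundedContinuousFunction ℝ E → ℝ → E := fun y s => Real.exp (K * s) • y s
  have hw : ∀ y, Continuous (w y) := fun y => by
    have := y.continuous
    fun_prop
  let P : BoundedContinuousFunction ℝ E → ℝ → E := fun y t =>
    Real.exp (-(K * c t)) • (x₀ + ∫ s in (0:ℝ)..(c t), H s (w y s))
  have hP : ∀ y, Continuous (P y) := fun y => by
    have h1 : Continuous fun t => ∫ s in (0:ℝ)..t, H s (w y s) :=
      intervalIntegral.continuous_primitive (hI _ (hw y)) 0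
    have h2 := h1.comp hc
    have h3 : Continuous fun t => Real.exp (-(K * c t)) := by fun_prop
    exact h3.smul (continuous_const.add h2)
  have hexp : ∀ t, Real.exp (-(K * c t)) ≤ 1 := fun t => by
    rw [Real.exp_le_one_iff]
    have := mul_nonneg hKpos.le (hc0 t)
    linarith
  have hPb : ∀ y t, ‖P y t‖ ≤ ‖x₀‖ + M * T := by
    intro y t
    have h1 : ‖∫ s in (0:ℝ)..(c t), H s (w y s)‖ ≤ M * |c t - 0| :=
      intervalIntegral.norm_integral_le_of_norm_le_const fun s _ => hb _ _
    rw [sub_zero, abs_of_nonneg (hc0 t)] at h1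
    have h2 := mul_le_mul_of_nonneg_left (hcT t) hM
    have h3 := norm_add_le x₀ (∫ s in (0:ℝ)..(c t), H s (w y s))
    simp only [P, norm_smul, Real.norm_eq_abs, Real.abs_exp]
    have h4 := mul_le_mul_of_nonneg_right (hexp t)
      (norm_nonneg (x₀ + ∫ s in (0:ℝ)..(c t), H s (w y s)))
    linarith
  let Φ : BoundedContinuousFunction ℝ E → BoundedContinuousFunction ℝ E := fun y =>
    BoundedContinuousFunction.ofNormedAddCommGroup (P y) (hP y) _ (hPb y)
  have hcontr : ContractingWith (1/2) Φ := by
    refine ⟨by rw [← NNReal.coe_lt_coe]; norm_num, LipschitzWith.of_dist_le_mul fun y z => ?_⟩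
    rw [BoundedContinuousFunction.dist_le (by positivity)]
    intro t
    change dist (P y t) (P z t) ≤ _
    rw [dist_eq_norm]
    simp only [P]
    rw [← smul_sub, add_sub_add_left_eq_sub, ← intervalIntegral.integral_sub (hI _ (hw y) _ _)
      (hI _ (hw z) _ _), norm_smul, Real.norm_eq_abs, Real.abs_exp]
    have h1 : ‖∫ s in (0:ℝ)..(c t), (H s (w y s) - H s (w z s))‖ ≤
        ∫ s in (0:ℝ)..(c t), L * dist y z * Real.exp (K * s) := by
      apply intervalIntegral.norm_integral_le_of_norm_le (hc0 t)
      · refine Eventually.of_forall fun s _ => (hl _ _ _).trans ?_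
        simp only [w]
        rw [← smul_sub, norm_smul, Real.norm_eq_abs, Real.abs_exp, ← dist_eq_norm]
        have := BoundedContinuousFunction.dist_coe_le_dist (f := y) (g := z) s
        have h2 := mul_le_mul_of_nonneg_left this (mul_nonneg hL (Real.exp_pos (K * s)).le)
        linarith
      · apply Continuous.intervalIntegrable; fun_prop
    have h2 : ∫ s in (0:ℝ)..(c t), L * dist y z * Real.exp (K * s)
        = L * dist y z * (K⁻¹ * (Real.exp (K * c t) - 1)) := by
      rw [intervalIntegral.integral_const_mul, intervalIntegral.integral_comp_mul_left 
        (fun s => Real.exp s) hKpos.ne']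
      simp
    rw [h2] at h1
    have h3 := mul_le_mul_of_nonneg_left h1 (Real.exp_pos (-(K * c t))).le
    refine h3.trans ?_
    have h4 : Real.exp (-(K * c t)) * Real.exp (K * c t) = 1 := by
      rw [← Real.exp_add]; simp
    have h5 : Real.exp (-(K * c t)) * (L * dist y z * (K⁻¹ * (Real.exp (K * c t) - 1)))
      = (L * K⁻¹) * dist y z * (1 - Real.exp (-(K * c t))) := by
        linear_combination (L * K⁻¹) * dist y z * h4
    rw [h5]
    have h6 : L * K⁻¹ ≤ 1/2 := by
      rw [← div_eq_mul_inv, div_le_iff₀ hKpos]; linarith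
    have h7 := Real.exp_pos (-(K * c t))
    have h8 := hexp t
    have h9 : 0 ≤ dist y z := dist_nonneg
    have h10 : 0 ≤ L * K⁻¹ := by positivity
    calc (L * K⁻¹) * dist y z * (1 - Real.exp (-(K * c t))) ≤ (L * K⁻¹) * dist y z * 1 := by
          gcongr; linarith
      _ ≤ _ := by rw [mul_one]; push_cast; gcongr
  have hfix : Function.IsFixedPt Φ (hcontr.fixedPoint Φ) := hcontr.fixedPoint_isFixedPt
  set y := hcontr.fixedPoint Φ
  refine ⟨w y, hw y, fun t ht => ?_⟩
  have hct : c t = t := by simp [c, ht.1, ht.2]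
  have h1 : y t = P y t := by
    conv_lhs => rw [← hfix]
    rfl
  simp only [P, hct] at h1
  change Real.exp (K * t) • y t = _
  rw [h1, smul_smul, ← Real.exp_add]
  simp

theorem tb_weak {T : ℝ} (hT : 0 < T) (u : ℕ → ℝ → ℝ) (hu : ∀ n, Measurable (u n))
    (hu1 : ∀ n s, u n s ∈ Icc (0:ℝ) 1) :
    ∃ v : ℝ → ℝ, Measurable v ∧ (∀ s, v s ∈ Icc (0:ℝ) 1) ∧ ∃ φ : ℕ → ℕ, StrictMono φ ∧
      ∀ g : ℝ → ℝ, Measurable g → (∃ C, ∀ s, |g s| ≤ C) →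
      Tendsto (fun n => ∫ s in (0:ℝ)..T, g s * u (φ n) s) atTop
        (𝓝 (∫ s in (0:ℝ)..T, g s * v s)) := by
  set ν := (volume : Measure ℝ).restrict (Ioc 0 T) with hν
  have hmem : ∀ g : ℝ → ℝ, Measurable g → (∃ C, ∀ s, |g s| ≤ C) → MemLp g 2 ν := by
    rintro g hg ⟨C, hC⟩
    exact MemLp.of_bound hg.aestronglyMeasurable C (Eventually.of_forall hC)
  have hub : ∀ n, ∃ C, ∀ s, |u n s| ≤ C := fun n => ⟨1, fun s => by
    rw [abs_of_nonneg (hu1 n s).1]; exact (hu1 n s).2⟩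
  let U : ℕ → Lp ℝ 2 ν := fun n => (hmem (u n) (hu n) (hub n)).toLp
  have hU : ∀ n, U n =ᵐ[ν] u n := fun n => MemLp.coeFn_toLp _
  obtain ⟨R, hR⟩ : ∃ R, ∀ n, ‖U n‖ ≤ R := by
    refine ⟨_, fun n => Lp.norm_le_of_ae_bound (C := 1) zero_le_one ?_⟩
    filter_upwards [hU n] with s hs
    rw [hs, Real.norm_eq_abs, abs_of_nonneg (hu1 n s).1]; exact (hu1 n s).2
  have : Fact ((2:ENNReal) ≠ ⊤) := ⟨by simp⟩
  have hsc := WeakDual.isSeqCompact_closedBall ℝ (Lp ℝ 2 ν) 0 R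
  obtain ⟨a, -, φ, hφ, hlim⟩ := hsc (x := fun n => StrongDual.toWeakDual
    (InnerProductSpace.toDual ℝ (Lp ℝ 2 ν) (U n))) (fun n => by
      simp
      exact hR n)
  let V : Lp ℝ 2 ν := (InnerProductSpace.toDual ℝ (Lp ℝ 2 ν)).symm (WeakDual.toStrongDual a)
  have hlim2 : ∀ g : Lp ℝ 2 ν, Tendsto (fun n => inner ℝ (U (φ n)) g) atTop (𝓝 (inner ℝ V g)) := by
    intro g
    have h1 := ((WeakDual.eval_continuous g).tendsto a).comp hlim
    have h2 : inner ℝ V g = a g := by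
      simp [V]
    rw [h2]
    exact h1
  have key : ∀ g : ℝ → ℝ, Measurable g → (∃ C, ∀ s, |g s| ≤ C) →
      Tendsto (fun n => ∫ s, g s * u (φ n) s ∂ν) atTop (𝓝 (∫ s, g s * V s ∂ν)) := by
    intro g hg hgb
    obtain ⟨G, hG⟩ : ∃ G : Lp ℝ 2 ν, G =ᵐ[ν] g := ⟨_, MemLp.coeFn_toLp (hmem g hg hgb)⟩
    have h1 := hlim2 G
    simp only [L2.inner_def] at h1
    have e1 : ∀ n, ∫ s, inner ℝ (U (φ n) s) (G s) ∂ν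
        = ∫ s, g s * u (φ n) s ∂ν := by
      intro n
      apply integral_congr_ae
      filter_upwards [hG, hU (φ n)] with s h1 h2
      rw [h1, h2]; simp
    have e2 : ∫ s, inner ℝ (V s) (G s) ∂ν = ∫ s, g s * V s ∂ν := by
      apply integral_congr_ae
      filter_upwards [hG] with s h1
      rw [h1]; simp
    rw [e2] at h1
    simpa only [e1] using h1
  have hVi : Integrable V ν := (Lp.memLp V).integrable (by norm_num)
  have hui : ∀ n, Integrable (u n) ν := fun n => 
    (hmem (u n) (hu n) (hub n)).integrable (by norm_num)
  have key2 : ∀ s : Set ℝ, MeasurableSet s → 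
      Tendsto (fun n => ∫ t in s, u (φ n) t ∂ν) atTop (𝓝 (∫ t in s, V t ∂ν)) := by
    intro s hs
    have h1 := key (s.indicator fun _ => 1) (measurable_const.indicator hs) ⟨1, fun t => by
      by_cases h : t ∈ s <;> simp [h]⟩
    have e : ∀ w : ℝ → ℝ, ∫ t, s.indicator (fun _ => (1:ℝ)) t * w t ∂ν = ∫ t in s, w t ∂ν := by
      intro w
      rw [← integral_indicator hs]
      congr 1; ext t; by_cases h : t ∈ s <;> simp [h]
    simpa only [e] using h1
  have hV0 : 0 ≤ᵐ[ν] V := by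
    refine ae_nonneg_of_forall_setIntegral_nonneg hVi fun s hs _ => ?_
    refine ge_of_tendsto' (key2 s hs) fun n => ?_
    exact integral_nonneg fun t => (hu1 _ t).1
  have hV1 : V ≤ᵐ[ν] fun _ => (1:ℝ) := by
    refine ae_le_of_forall_setIntegral_le hVi (integrable_const _) fun s hs _ => ?_
    refine le_of_tendsto' (key2 s hs) fun n => ?_
    exact integral_mono (hui _).integrableOn (integrable_const _) fun t => (hu1 _ t).2
  have hVm : AEMeasurable V ν := hVi.aemeasurable
  refine ⟨fun s => max 0 (min (hVm.mk V s) 1), ?_, ?_, φ, hφ, ?_⟩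
  · exact measurable_const.max (hVm.measurable_mk.min measurable_const)
  · exact fun s => ⟨le_max_left _ _, max_le zero_le_one (min_le_right _ _)⟩
  · intro g hg hgb
    have h1 := key g hg hgb
    simp only [intervalIntegral.integral_of_le hT.le]
    have e2 : ∫ s, g s * V s ∂ν = ∫ s, g s * max 0 (min (hVm.mk V s) 1) ∂ν := by
      apply integral_congr_ae
      filter_upwards [hV0, hV1, hVm.ae_eq_mk] with s h1 h2 h3
      have h1' : (0:ℝ) ≤ V s := h1
      rw [← h3, min_eq_left h2, max_eq_right h1']
    rw [← e2]
    exact h1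

structure TbOK (N μ : ℝ) (F : (Fin 5 → ℝ) → ℝ → ℝ → Fin 5 → ℝ) (w1 w2 : Fin 5 → ℝ) : Prop where
  lip : ∀ M, ∃ L, 0 ≤ L ∧ ∀ x y : Fin 5 → ℝ, ‖x‖ ≤ M → ‖y‖ ≤ M → ∀ u1 ∈ Icc (0:ℝ) 1,
    ∀ u2 ∈ Icc (0:ℝ) 1, ‖F x u1 u2 - F y u1 u2‖ ≤ L * ‖x - y‖
  cont : Continuous (fun p : (Fin 5 → ℝ) × ℝ × ℝ => F p.1 p.2.1 p.2.2)
  pos : ∀ (x : Fin 5 → ℝ) (i : Fin 5), (∀ j, 0 ≤ x j) → x i = 0 → ∀ u1 ∈ Icc (0:ℝ) 1,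
    ∀ u2 ∈ Icc (0:ℝ) 1, 0 ≤ F x u1 u2 i
  sum : ∀ x u1 u2, ∑ i, F x u1 u2 i = μ * N - μ * ∑ i, x i
  aff : ∀ x u1 u2 v1 v2, F x u1 u2 - F x v1 v2 = ((u1 - v1) * x 2) • w1 + ((u2 - v2) * x 3) • w2

theorem tb_meas {N μ : ℝ} {F : (Fin 5 → ℝ) → ℝ → ℝ → Fin 5 → ℝ} {w1 w2 : Fin 5 → ℝ}
    (hF : TbOK N μ F w1 w2) {x : ℝ → Fin 5 → ℝ} (hx : Measurable x) {u1 u2 : ℝ → ℝ}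
    (hu1 : Measurable u1) (hu2 : Measurable u2) : Measurable fun s => F (x s) (u1 s) (u2 s) :=
  hF.cont.measurable.comp (hx.prodMk (hu1.prodMk hu2))

theorem tb_bdd {N μ : ℝ} {F : (Fin 5 → ℝ) → ℝ → ℝ → Fin 5 → ℝ} {w1 w2 : Fin 5 → ℝ}
    (hF : TbOK N μ F w1 w2) (M : ℝ) : ∃ C, ∀ x : Fin 5 → ℝ, ‖x‖ ≤ M → ∀ u1 ∈ Icc (0:ℝ) 1,
    ∀ u2 ∈ Icc (0:ℝ) 1, ‖F x u1 u2‖ ≤ C := by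
  have hc : IsCompact (Metric.closedBall (0 : Fin 5 → ℝ) M ×ˢ (Icc (0:ℝ) 1 ×ˢ Icc (0:ℝ) 1)) :=
    (isCompact_closedBall _ _).prod (isCompact_Icc.prod isCompact_Icc)
  obtain ⟨C, hC⟩ := hc.exists_bound_of_continuousOn hF.cont.continuousOn
  exact ⟨C, fun x hx u1 h1 u2 h2 => hC (x, u1, u2) ⟨by simpa using hx, h1, h2⟩⟩

theorem tb_intble {N μ : ℝ} {F : (Fin 5 → ℝ) → ℝ → ℝ → Fin 5 → ℝ} {w1 w2 : Fin 5 → ℝ}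
    (hF : TbOK N μ F w1 w2) {M : ℝ} {x : ℝ → Fin 5 → ℝ} (hx : Continuous x)
    (hxM : ∀ t, ‖x t‖ ≤ M) {u1 u2 : ℝ → ℝ}
    (hu1 : Measurable u1) (hu2 : Measurable u2) (hu1' : ∀ s, u1 s ∈ Icc (0:ℝ) 1)
    (hu2' : ∀ s, u2 s ∈ Icc (0:ℝ) 1) (a b : ℝ) :
    IntervalIntegrable (fun s => F (x s) (u1 s) (u2 s)) volume a b := by
  obtain ⟨C, hC⟩ := tb_bdd hF M
  exact (intervalIntegrable_const (c := C)).mono_fun 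
    (tb_meas hF hx.measurable hu1 hu2).aestronglyMeasurable
      (Eventually.of_forall fun s => (hC _ (hxM s) _ (hu1' s) _ (hu2' s)).trans (le_abs_self C))

theorem tb_box_norm {N : ℝ} (hN : 0 ≤ N) {v : Fin 5 → ℝ} (h : ∀ i, v i ∈ Icc 0 N) : ‖v‖ ≤ N := by
  rw [pi_norm_le_iff_of_nonneg hN]
  intro i
  rw [Real.norm_eq_abs, abs_of_nonneg (h i).1]; exact (h i).2

theorem tb_box {N μ : ℝ} (hN : 0 < N) (hμ : 0 < μ)
    {F : (Fin 5 → ℝ) → ℝ → ℝ → Fin 5 → ℝ} {w1 w2 : Fin 5 → ℝ}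
    (hF : TbOK N μ F w1 w2) {T : ℝ} (hT : 0 < T) (x₀ : Fin 5 → ℝ) (hx₀ : ∀ i, 0 ≤ x₀ i)
    (hx₀s : ∑ i, x₀ i = N) {u1 u2 : ℝ → ℝ}
    (hu1 : Measurable u1) (hu2 : Measurable u2) (hu1' : ∀ s, u1 s ∈ Icc (0:ℝ) 1)
    (hu2' : ∀ s, u2 s ∈ Icc (0:ℝ) 1) :
    ∃ x : ℝ → Fin 5 → ℝ, Continuous x ∧ (∀ t i, x t i ∈ Icc 0 N) ∧
      ∀ t ∈ Icc 0 T, x t = x₀ + ∫ s in (0:ℝ)..t, F (x s) (u1 s) (u2 s) := by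
  let P : (Fin 5 → ℝ) → Fin 5 → ℝ := fun v i => max 0 (min (v i) N)
  have hPc : Continuous P := by fun_prop
  have hPb : ∀ v i, P v i ∈ Icc 0 N := fun v i => ⟨le_max_left _ _, max_le hN.le (min_le_right _ _)⟩
  have hPn : ∀ v, ‖P v‖ ≤ N := fun v => tb_box_norm hN.le (hPb v)
  have hPl : ∀ v w, ‖P v - P w‖ ≤ ‖v - w‖ := by
    intro v w
    rw [pi_norm_le_iff_of_nonneg (norm_nonneg _)]
    intro i
    have h1 := norm_le_pi_norm (v - w) i
    refine le_trans ?_ h1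
    simp only [P, Pi.sub_apply, Real.norm_eq_abs]
    have h2 := abs_max_sub_max_le_abs (min (v i) N) (min (w i) N) 0
    have h3 := abs_min_sub_min_le_max (v i) N (w i) N
    rw [max_comm 0, max_comm 0]
    simp at h3
    exact h2.trans h3
  obtain ⟨L, hL, hlip⟩ := hF.lip N
  obtain ⟨C, hC⟩ := tb_bdd hF N
  obtain ⟨x, hx, hsol⟩ := tb_exists (T := T) hT.le hL (fun s v => F (P v) (u1 s) (u2 s))
    (fun w hw => (tb_meas hF (hPc.comp hw).measurable hu1 hu2).aestronglyMeasurable)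
    (fun s v => hC _ (hPn v) _ (hu1' s) _ (hu2' s))
    (fun s v w => (hlip _ _ (hPn v) (hPn w) _ (hu1' s) _ (hu2' s)).trans
      (mul_le_mul_of_nonneg_left (hPl v w) hL)) x₀
  have hint := tb_intble hF (hPc.comp hx) (fun t => hPn (x t)) hu1 hu2 hu1' hu2'
  simp only [Function.comp] at hint
  have hlin : ∀ (l : (Fin 5 → ℝ) →L[ℝ] ℝ), ∀ t ∈ Icc 0 T,
      l (x t) = l x₀ + ∫ s in (0:ℝ)..t, l (F (P (x s)) (u1 s) (u2 s)) := by
    intro l t ht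
    rw [ContinuousLinearMap.intervalIntegral_comp_comm l (hint 0 t), ← map_add, ← hsol t ht]
  have hlint : ∀ (l : (Fin 5 → ℝ) →L[ℝ] ℝ) a b,
      IntervalIntegrable (fun s => l (F (P (x s)) (u1 s) (u2 s))) volume a b := by
    intro l a b
    exact ⟨l.integrable_comp (hint a b).1, l.integrable_comp (hint a b).2⟩
  have hpos : ∀ i, ∀ t ∈ Icc 0 T, 0 ≤ x t i := by
    intro i
    refine tb_pos (hx₀ i) (by fun_prop) (fun t _ => hlint (ContinuousLinearMap.proj i) 0 t)
      (hlin (ContinuousLinearMap.proj i)) ?_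
    intro t ht hneg
    refine hF.pos _ i (fun j => (hPb _ j).1) ?_ _ (hu1' t) _ (hu2' t)
    exact max_eq_left ((min_le_left _ _).trans hneg.le)
  have hsum : ∀ t ∈ Icc 0 T, 0 ≤ N - ∑ i, x t i := by
    let l : (Fin 5 → ℝ) →L[ℝ] ℝ := -∑ i, ContinuousLinearMap.proj i
    have hl : ∀ v, l v = -∑ i, v i := fun v => by simp [l]
    refine tb_pos (a := fun s => l (F (P (x s)) (u1 s) (u2 s))) (le_refl (0:ℝ)) (by fun_prop)
      (fun t _ => hlint l 0 t) (fun t ht => ?_) ?_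
    · have := hlin l t ht
      rw [hl, hl, hx₀s] at this
      linarith
    · intro t ht hneg
      rw [hl, hF.sum]
      have : N ≤ ∑ i, P (x t) i := by
        by_cases h : ∃ i, N ≤ x t i
        · obtain ⟨i, hi⟩ := h
          have h1 : P (x t) i = N := by
            simp only [P]; rw [min_eq_right hi, max_eq_right hN.le]
          rw [← h1]
          exact Finset.single_le_sum (fun j _ => (hPb (x t) j).1) (Finset.mem_univ i)
        · push Not at h
          have h1 : P (x t) = x t := by
            ext i; simp only [P]; rw [min_eq_left (h i).le, max_eq_right (hpos i t ht)]
          rw [h1]; linarith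
      nlinarith
  have hbox : ∀ t ∈ Icc 0 T, ∀ i, x t i ∈ Icc 0 N := by
    intro t ht i
    refine ⟨hpos i t ht, ?_⟩
    have h1 := Finset.single_le_sum (f := fun i => x t i) (fun j _ => hpos j t ht)
      (Finset.mem_univ i)
    have h2 := hsum t ht
    linarith
  let c : ℝ → ℝ := fun t => max 0 (min t T)
  have hc : Continuous c := by fun_prop
  have hcI : ∀ t, c t ∈ Icc 0 T := fun t => ⟨le_max_left _ _, max_le hT.le (min_le_right _ _)⟩
  have hct : ∀ t ∈ Icc 0 T, c t = t := fun t ht => by simp [c, ht.1, ht.2]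
  refine ⟨fun t => x (c t), hx.comp hc, fun t => hbox _ (hcI t), fun t ht => ?_⟩
  simp only [hct t ht]
  rw [hsol t ht]
  congr 1
  apply intervalIntegral.integral_congr
  intro s hs
  rw [uIcc_of_le ht.1] at hs
  have hs' : s ∈ Icc 0 T := ⟨hs.1, hs.2.trans ht.2⟩
  have h1 : P (x s) = x s := by
    ext i; simp only [P]
    rw [min_eq_left (hbox s hs' i).2, max_eq_right (hbox s hs' i).1]
  simp only [h1, hct s hs']

theorem tb_cmp {N μ : ℝ} {F : (Fin 5 → ℝ) → ℝ → ℝ → Fin 5 → ℝ} {w1 w2 : Fin 5 → ℝ}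
    (hF : TbOK N μ F w1 w2) {T M L : ℝ} {x₀ : Fin 5 → ℝ}
    (hL : ∀ x y : Fin 5 → ℝ, ‖x‖ ≤ M → ‖y‖ ≤ M → ∀ u1 ∈ Icc (0:ℝ) 1,
    ∀ u2 ∈ Icc (0:ℝ) 1, ‖F x u1 u2 - F y u1 u2‖ ≤ L * ‖x - y‖)
    {u1 u2 v1 v2 : ℝ → ℝ}
    (hu1 : Measurable u1) (hu2 : Measurable u2) (hu1' : ∀ s, u1 s ∈ Icc (0:ℝ) 1)
    (hu2' : ∀ s, u2 s ∈ Icc (0:ℝ) 1)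
    (hv1 : Measurable v1) (hv2 : Measurable v2) (hv1' : ∀ s, v1 s ∈ Icc (0:ℝ) 1)
    (hv2' : ∀ s, v2 s ∈ Icc (0:ℝ) 1)
    {x y : ℝ → Fin 5 → ℝ} (hx : Continuous x) (hy : Continuous y) (hxM : ∀ t, ‖x t‖ ≤ M)
    (hyM : ∀ t, ‖y t‖ ≤ M)
    (hxs : ∀ t ∈ Icc 0 T, x t = x₀ + ∫ s in (0:ℝ)..t, F (x s) (u1 s) (u2 s))
    (hys : ∀ t ∈ Icc 0 T, y t = x₀ + ∫ s in (0:ℝ)..t, F (y s) (v1 s) (v2 s)) :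
    ∀ t ∈ Icc 0 T, ‖x t - y t‖ ≤ L * (∫ s in (0:ℝ)..t, ‖x s - y s‖) +
      (|∫ s in (0:ℝ)..t, (u1 s - v1 s) * y s 2| * ‖w1‖ +
        |∫ s in (0:ℝ)..t, (u2 s - v2 s) * y s 3| * ‖w2‖) := by
  intro t ht
  have i1 := tb_intble hF hx hxM hu1 hu2 hu1' hu2' 0 t
  have i2 := tb_intble hF hy hyM hu1 hu2 hu1' hu2' 0 t
  have i3 := tb_intble hF hy hyM hv1 hv2 hv1' hv2' 0 t
  have hb : ∀ (a b : ℝ → ℝ) (i : Fin 5), Measurable a → Measurable b → (∀ s, a s ∈ Icc (0:ℝ) 1) →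
      (∀ s, b s ∈ Icc (0:ℝ) 1) → 
      IntervalIntegrable (fun s => (a s - b s) * y s i) volume 0 t := by
    intro a b i ha hb ha' hb'
    refine (intervalIntegrable_const (c := M)).mono_fun (((ha.sub hb).mul 
      (by fun_prop)).aestronglyMeasurable) (Eventually.of_forall fun s => ?_)
    have h1 : |a s - b s| ≤ 1 := abs_le.2 ⟨by linarith [(ha' s).1, (hb' s).2],
      by linarith [(ha' s).2, (hb' s).1]⟩
    have h2 := (norm_le_pi_norm (y s) i).trans (hyM s)
    change ‖(a s - b s) * y s i‖ ≤ ‖M‖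
    rw [norm_mul, Real.norm_eq_abs (a s - b s)]
    refine le_trans ?_ (le_abs_self M)
    have := mul_le_mul_of_nonneg_right h1 (norm_nonneg (y s i))
    linarith
  have j1 := hb u1 v1 2 hu1 hv1 hu1' hv1'
  have j2 := hb u2 v2 3 hu2 hv2 hu2' hv2'
  have e : x t - y t = (∫ s in (0:ℝ)..t, (F (x s) (u1 s) (u2 s) - F (y s) (u1 s) (u2 s))) +
      ((∫ s in (0:ℝ)..t, (u1 s - v1 s) * y s 2) • w1 +
       (∫ s in (0:ℝ)..t, (u2 s - v2 s) * y s 3) • w2) := by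
    rw [← intervalIntegral.integral_smul_const, ← intervalIntegral.integral_smul_const,
      ← intervalIntegral.integral_add (f := fun s => ((u1 s - v1 s) * y s 2) • w1)
      (g := fun s => ((u2 s - v2 s) * y s 3) • w2)
      ⟨j1.1.smul_const w1, j1.2.smul_const w1⟩ ⟨j2.1.smul_const w2, j2.2.smul_const w2⟩]
    simp only [← hF.aff]
    rw [intervalIntegral.integral_sub i1 i2, intervalIntegral.integral_sub i2 i3, hxs t ht,
      hys t ht]
    abel
  rw [e]
  refine (norm_add_le _ _).trans (add_le_add ?_ ((norm_add_le _ _).trans ?_))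
  · rw [← intervalIntegral.integral_const_mul]
    apply intervalIntegral.norm_integral_le_of_norm_le ht.1
    · exact Eventually.of_forall fun s _ => hL _ _ (hxM s) (hyM s) _ (hu1' s) _ (hu2' s)
    · apply Continuous.intervalIntegrable; fun_prop
  · rw [norm_smul, norm_smul, Real.norm_eq_abs, Real.norm_eq_abs]


theorem tb_uniq {N μ : ℝ} {F : (Fin 5 → ℝ) → ℝ → ℝ → Fin 5 → ℝ} {w1 w2 : Fin 5 → ℝ}
    (hF : TbOK N μ F w1 w2) {T : ℝ} (hT : 0 < T) {x₀ : Fin 5 → ℝ}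
    {u1 u2 : ℝ → ℝ}
    (hu1 : Measurable u1) (hu2 : Measurable u2) (hu1' : ∀ s, u1 s ∈ Icc (0:ℝ) 1)
    (hu2' : ∀ s, u2 s ∈ Icc (0:ℝ) 1)
    {x y : ℝ → Fin 5 → ℝ} (hx : ContinuousOn x (Icc 0 T)) (hy : ContinuousOn y (Icc 0 T))
    (hxs : ∀ t ∈ Icc 0 T, x t = x₀ + ∫ s in (0:ℝ)..t, F (x s) (u1 s) (u2 s))
    (hys : ∀ t ∈ Icc 0 T, y t = x₀ + ∫ s in (0:ℝ)..t, F (y s) (u1 s) (u2 s)) :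
    ∀ t ∈ Icc 0 T, x t = y t := by
  let c : ℝ → ℝ := fun t => max 0 (min t T)
  have hc : Continuous c := by fun_prop
  have hcI : ∀ t, c t ∈ Icc 0 T := fun t => ⟨le_max_left _ _, max_le hT.le (min_le_right _ _)⟩
  have hct : ∀ t ∈ Icc 0 T, c t = t := fun t ht => by simp [c, ht.1, ht.2]
  have ext : ∀ z : ℝ → Fin 5 → ℝ, ContinuousOn z (Icc 0 T) →
      (∀ t ∈ Icc 0 T, z t = x₀ + ∫ s in (0:ℝ)..t, F (z s) (u1 s) (u2 s)) →
      Continuous (fun t => z (c t)) ∧ (∃ M, ∀ t, ‖z (c t)‖ ≤ M) ∧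
      ∀ t ∈ Icc 0 T, z (c t) = x₀ + ∫ s in (0:ℝ)..t, F (z (c s)) (u1 s) (u2 s) := by
    intro z hz hzs
    refine ⟨hz.comp_continuous hc hcI, ?_, fun t ht => ?_⟩
    · obtain ⟨M, hM⟩ := isCompact_Icc.exists_bound_of_continuousOn hz
      exact ⟨M, fun t => hM _ (hcI t)⟩
    · rw [hct t ht, hzs t ht]
      congr 1
      apply intervalIntegral.integral_congr
      intro s hs
      rw [uIcc_of_le ht.1] at hs
      simp only [hct s ⟨hs.1, hs.2.trans ht.2⟩]
  obtain ⟨a1, ⟨M1, a2⟩, a3⟩ := ext x hx hxs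
  obtain ⟨b1, ⟨M2, b2⟩, b3⟩ := ext y hy hys
  obtain ⟨L, hL0, hL⟩ := hF.lip (max M1 M2)
  have key := tb_cmp hF hL hu1 hu2 hu1' hu2' hu1 hu2 hu1' hu2' a1 b1
    (fun t => (a2 t).trans (le_max_left _ _)) (fun t => (b2 t).trans (le_max_right _ _)) a3 b3
  simp only [sub_self, zero_mul, intervalIntegral.integral_zero, abs_zero, add_zero] at key
  intro t ht
  have h1 := tb_gronwall (T := t) (L := L) (f := fun s => ‖x (c s) - y (c s)‖) (e := fun _ => 0)
    ht.1 hL0 (a1.sub b1).norm continuous_const (fun _ => le_rfl) (fun s hs => by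
      rw [add_zero]; exact key s ⟨hs.1, hs.2.trans ht.2⟩)
  simp only [intervalIntegral.integral_zero, mul_zero] at h1
  have h2 := key t ht
  have h3 := mul_nonpos_of_nonneg_of_nonpos hL0 h1
  rw [hct t ht] at h2
  exact sub_eq_zero.1 (norm_le_zero_iff.1 (h2.trans h3))

theorem tb_abs {N μ : ℝ} (hN : 0 < N) (hμ : 0 < μ)
    {F : (Fin 5 → ℝ) → ℝ → ℝ → Fin 5 → ℝ} {w1 w2 : Fin 5 → ℝ}
    (hF : TbOK N μ F w1 w2) {T : ℝ} (hT : 0 < T) (x₀ : Fin 5 → ℝ) (hx₀ : ∀ i, 0 ≤ x₀ i)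
    (hx₀s : ∑ i, x₀ i = N) {W1 W2 : ℝ} (hW1 : 0 < W1) (hW2 : 0 < W2) :
    ∃ (v1 v2 : ℝ → ℝ) (y : ℝ → Fin 5 → ℝ), Measurable v1 ∧ Measurable v2 ∧
      (∀ s, v1 s ∈ Icc (0:ℝ) 1) ∧ (∀ s, v2 s ∈ Icc (0:ℝ) 1) ∧ Continuous y ∧
      (∀ t ∈ Icc 0 T, y t = x₀ + ∫ s in (0:ℝ)..t, F (y s) (v1 s) (v2 s)) ∧
      ∀ (u1 u2 : ℝ → ℝ) (x : ℝ → Fin 5 → ℝ), Measurable u1 → Measurable u2 →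
      (∀ s ∈ Icc 0 T, u1 s ∈ Icc (0:ℝ) 1 ∧ u2 s ∈ Icc (0:ℝ) 1) → ContinuousOn x (Icc 0 T) →
      (∀ t ∈ Icc 0 T, x t = x₀ + ∫ s in (0:ℝ)..t, F (x s) (u1 s) (u2 s)) →
      tbCost W1 W2 T v1 v2 y ≤ tbCost W1 W2 T u1 u2 x := by
  let A : (ℝ → ℝ) → (ℝ → ℝ) → (ℝ → Fin 5 → ℝ) → Prop := fun u1 u2 x =>
    Measurable u1 ∧ Measurable u2 ∧
      (∀ s, u1 s ∈ Icc (0:ℝ) 1) ∧ (∀ s, u2 s ∈ Icc (0:ℝ) 1) ∧ Continuous x ∧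
      (∀ t i, x t i ∈ Icc 0 N) ∧
      (∀ t ∈ Icc 0 T, x t = x₀ + ∫ s in (0:ℝ)..t, F (x s) (u1 s) (u2 s))
  -- reduction to globally admissible data
  have hred : ∀ (u1 u2 : ℝ → ℝ) (x : ℝ → Fin 5 → ℝ), Measurable u1 → Measurable u2 →
      (∀ s ∈ Icc 0 T, u1 s ∈ Icc (0:ℝ) 1 ∧ u2 s ∈ Icc (0:ℝ) 1) → ContinuousOn x (Icc 0 T) →
      (∀ t ∈ Icc 0 T, x t = x₀ + ∫ s in (0:ℝ)..t, F (x s) (u1 s) (u2 s)) →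
      ∃ u1' u2' x', A u1' u2' x' ∧ tbCost W1 W2 T u1' u2' x' = tbCost W1 W2 T u1 u2 x := by
    intro u1 u2 x hu1 hu2 hu hx hxs
    let k : (ℝ → ℝ) → ℝ → ℝ := fun u s => max 0 (min (u s) 1)
    have km : ∀ u, Measurable u → Measurable (k u) := fun u hu =>
      measurable_const.max (hu.min measurable_const)
    have kI : ∀ u s, k u s ∈ Icc (0:ℝ) 1 := fun u s =>
      ⟨le_max_left _ _, max_le zero_le_one (min_le_right _ _)⟩
    have ke : ∀ u s, u s ∈ Icc (0:ℝ) 1 → k u s = u s := fun u s h => by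
      simp only [k]; rw [min_eq_left h.2, max_eq_right h.1]
    obtain ⟨y, hy, hyb, hys⟩ := tb_box hN hμ hF hT x₀ hx₀ hx₀s (km u1 hu1) (km u2 hu2)
      (kI u1) (kI u2)
    have hxs' : ∀ t ∈ Icc 0 T, x t = x₀ + ∫ s in (0:ℝ)..t, F (x s) (k u1 s) (k u2 s) := by
      intro t ht
      rw [hxs t ht]
      congr 1
      apply intervalIntegral.integral_congr
      intro s hs
      rw [uIcc_of_le ht.1] at hs
      have := hu s ⟨hs.1, hs.2.trans ht.2⟩
      simp only [ke _ _ this.1, ke _ _ this.2]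
    have heq := tb_uniq hF hT (km u1 hu1) (km u2 hu2) (kI u1) (kI u2) hx hy.continuousOn hxs' hys
    refine ⟨k u1, k u2, y, ⟨km u1 hu1, km u2 hu2, kI u1, kI u2, hy, hyb, hys⟩, ?_⟩
    apply intervalIntegral.integral_congr
    intro s hs
    rw [uIcc_of_le hT.le] at hs
    simp only [ke _ _ (hu s hs).1, ke _ _ (hu s hs).2, heq s hs]
  let S : Set ℝ := {r | ∃ u1 u2 x, A u1 u2 x ∧ tbCost W1 W2 T u1 u2 x = r}
  have hSne : S.Nonempty := by
    have h0 : ∀ s : ℝ, (fun _ : ℝ => (0:ℝ)) s ∈ Icc (0:ℝ) 1 := fun s => ⟨le_rfl, zero_le_one⟩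
    obtain ⟨y, hy, hyb, hys⟩ := tb_box hN hμ hF hT x₀ hx₀ hx₀s
      (u1 := fun _ => 0) (u2 := fun _ => 0) measurable_const measurable_const h0 h0
    exact ⟨_, _, _, y, ⟨measurable_const, measurable_const, h0, h0, hy, hyb, hys⟩, rfl⟩
  have hSb : BddBelow S := by
    refine ⟨0, ?_⟩
    rintro r ⟨u1, u2, x, ⟨-, -, -, -, -, hb, -⟩, rfl⟩
    apply intervalIntegral.integral_nonneg hT.le
    intro s _
    have h1 := (hb s 2).1
    have h2 := (hb s 3).1
    positivity
  obtain ⟨r, -, hrlim, hrS⟩ := exists_seq_tendsto_sInf hSne hSb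
  choose u1 u2 x hA hJ using hrS
  obtain ⟨v1, hv1, hv1', φ, hφ, hw1⟩ := tb_weak hT u1 (fun n => (hA n).1) (fun n => (hA n).2.2.1)
  obtain ⟨v2, hv2, hv2', ψ, hψ, hw2⟩ := tb_weak hT (fun n => u2 (φ n)) (fun n => (hA _).2.1)
    (fun n => (hA _).2.2.2.1)
  obtain ⟨y, hy, hyb, hys⟩ := tb_box hN hμ hF hT x₀ hx₀ hx₀s hv1 hv2 hv1' hv2'
  refine ⟨v1, v2, y, hv1, hv2, hv1', hv2', hy, hys, ?_⟩
  suffices hmain : tbCost W1 W2 T v1 v2 y ≤ sInf S by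
    intro u1 u2 x h1 h2 h3 h4 h5
    obtain ⟨u1', u2', x', hA', hJ'⟩ := hred u1 u2 x h1 h2 h3 h4 h5
    rw [← hJ']
    exact hmain.trans (csInf_le hSb ⟨u1', u2', x', hA', rfl⟩)
  set θ : ℕ → ℕ := fun n => φ (ψ n) with hθ
  have hθm : Tendsto θ atTop atTop := (hφ.comp hψ).tendsto_atTop
  have hw1' : ∀ g : ℝ → ℝ, Measurable g → (∃ C, ∀ s, |g s| ≤ C) →
      Tendsto (fun n => ∫ s in (0:ℝ)..T, g s * u1 (θ n) s) atTop
        (𝓝 (∫ s in (0:ℝ)..T, g s * v1 s)) := fun g hg hb =>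
    (hw1 g hg hb).comp hψ.tendsto_atTop
  have hw2' : ∀ g : ℝ → ℝ, Measurable g → (∃ C, ∀ s, |g s| ≤ C) →
      Tendsto (fun n => ∫ s in (0:ℝ)..T, g s * u2 (θ n) s) atTop
        (𝓝 (∫ s in (0:ℝ)..T, g s * v2 s)) := hw2
  have hI : ∀ g : ℝ → ℝ, Measurable g → (∃ C, ∀ s, |g s| ≤ C) → ∀ a b,
      IntervalIntegrable g volume a b := by
    rintro g hg ⟨C, hC⟩ a b
    exact (intervalIntegrable_const (c := C)).mono_fun hg.aestronglyMeasurable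
      (Eventually.of_forall fun s => (hC s).trans (le_abs_self C))
  have hub : ∀ u : ℝ → ℝ, (∀ s, u s ∈ Icc (0:ℝ) 1) → ∀ s, |u s| ≤ 1 := fun u hu s => by
    rw [abs_of_nonneg (hu s).1]; exact (hu s).2
  -- the error terms
  have herr : ∀ (u : ℕ → ℝ → ℝ) (v : ℝ → ℝ) (i : Fin 5), (∀ n, Measurable (u n)) →
      (∀ n s, u n s ∈ Icc (0:ℝ) 1) → Measurable v → (∀ s, v s ∈ Icc (0:ℝ) 1) →
      (∀ g : ℝ → ℝ, Measurable g → (∃ C, ∀ s, |g s| ≤ C) →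
      Tendsto (fun n => ∫ s in (0:ℝ)..T, g s * u n s) atTop (𝓝 (∫ s in (0:ℝ)..T, g s * v s))) →
      (∀ n, Continuous fun t => |∫ s in (0:ℝ)..t, (u n s - v s) * y s i|) ∧
      Tendsto (fun n => ∫ t in (0:ℝ)..T, |∫ s in (0:ℝ)..t, (u n s - v s) * y s i|) atTop (𝓝 0) := by
    intro u v i hu hu' hv hv' hlim
    have hyi : Measurable fun s => y s i := by fun_prop
    have hbd : ∀ n s, |(u n s - v s) * y s i| ≤ N := by
      intro n s
      have h1 : |u n s - v s| ≤ 1 := abs_le.2 ⟨by linarith [(hu' n s).1, (hv' s).2],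
        by linarith [(hu' n s).2, (hv' s).1]⟩
      rw [abs_mul, abs_of_nonneg (hyb s i).1]
      have := mul_le_mul_of_nonneg_right h1 (hyb s i).1
      linarith [(hyb s i).2]
    have hii : ∀ n a b, IntervalIntegrable (fun s => (u n s - v s) * y s i) volume a b := fun n =>
      hI _ (((hu n).sub hv).mul hyi) ⟨N, hbd n⟩
    have hcont : ∀ n, Continuous fun t => |∫ s in (0:ℝ)..t, (u n s - v s) * y s i| := fun n =>
      (intervalIntegral.continuous_primitive (hii n) 0).abs
    refine ⟨hcont, ?_⟩
    have hpt : ∀ t ∈ Icc 0 T,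
        Tendsto (fun n => |∫ s in (0:ℝ)..t, (u n s - v s) * y s i|) atTop (𝓝 0) := by
      intro t ht
      let g : ℝ → ℝ := (Iic t).indicator fun s => y s i
      have hg : Measurable g := hyi.indicator measurableSet_Iic
      have hgb : ∀ s, |g s| ≤ N := by
        intro s
        by_cases h : s ∈ Iic t
        · simp only [g, indicator_of_mem h]
          rw [abs_of_nonneg (hyb s i).1]; exact (hyb s i).2
        · simp only [g, indicator_of_notMem h]; simpa using hN.le
      have hgI : ∀ u : ℝ → ℝ, Measurable u → (∀ s, u s ∈ Icc (0:ℝ) 1) →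
          IntervalIntegrable (fun s => g s * u s) volume 0 T := by
        intro u hu hu'
        refine hI _ (hg.mul hu) ⟨N, fun s => ?_⟩ _ _
        rw [Pi.mul_apply, abs_mul]
        have := mul_le_mul (hgb s) (hub u hu' s) (abs_nonneg _) hN.le
        linarith
      have e : ∀ n, ∫ s in (0:ℝ)..t, (u n s - v s) * y s i =
          (∫ s in (0:ℝ)..T, g s * u n s) - ∫ s in (0:ℝ)..T, g s * v s := by
        intro n
        rw [← intervalIntegral.integral_sub (hgI _ (hu n) (hu' n)) (hgI _ hv hv')]
        rw [← intervalIntegral.integral_indicator (a₁ := 0) (a₂ := t) (a₃ := T)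
          (f := fun s => (u n s - v s) * y s i) ht]
        congr 1
        ext s
        by_cases h : s ≤ t
        · simp [g, h]; ring
        · simp [g, h]
      simp only [e]
      have h1 := ((hlim g hg ⟨N, hgb⟩).sub_const (∫ s in (0:ℝ)..T, g s * v s)).abs
      simpa using h1
    have := intervalIntegral.tendsto_integral_filter_of_dominated_convergence (μ := volume)
      (a := 0) (b := T) (l := atTop) (f := fun _ => (0:ℝ))
      (F := fun n t => |∫ s in (0:ℝ)..t, (u n s - v s) * y s i|) (fun _ => N * T)
      (Eventually.of_forall fun n => (hcont n).aestronglyMeasurable)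
      (Eventually.of_forall fun n => Eventually.of_forall fun t ht => ?_)
      intervalIntegrable_const (Eventually.of_forall fun t ht => ?_)
    · simpa using this
    · rw [uIoc_of_le hT.le] at ht
      rw [Real.norm_eq_abs, abs_abs]
      have h1 : ‖∫ s in (0:ℝ)..t, (u n s - v s) * y s i‖ ≤ N * |t - 0| :=
        intervalIntegral.norm_integral_le_of_norm_le_const fun s _ => hbd n s
      rw [sub_zero, abs_of_nonneg ht.1.le] at h1
      exact h1.trans (mul_le_mul_of_nonneg_left ht.2 hN.le)
    · rw [uIoc_of_le hT.le] at ht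
      exact hpt t ⟨ht.1.le, ht.2⟩
  obtain ⟨c1, l1⟩ := herr (fun n => u1 (θ n)) v1 2 (fun n => (hA _).1) (fun n => (hA _).2.2.1)
    hv1 hv1' hw1'
  obtain ⟨c2, l2⟩ := herr (fun n => u2 (θ n)) v2 3 (fun n => (hA _).2.1) (fun n => (hA _).2.2.2.1)
    hv2 hv2' hw2'
  obtain ⟨L, hL0, hL⟩ := hF.lip N
  have hxc : ∀ n, Continuous (x n) := fun n => (hA n).2.2.2.2.1
  have hxb : ∀ n t i, x n t i ∈ Icc 0 N := fun n => (hA n).2.2.2.2.2.1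
  have hf0 : Tendsto (fun n => ∫ t in (0:ℝ)..T, ‖x (θ n) t - y t‖) atTop (𝓝 0) := by
    have hup : Tendsto (fun n => Real.exp (L * T) *
        ((∫ t in (0:ℝ)..T, |∫ s in (0:ℝ)..t, (u1 (θ n) s - v1 s) * y s 2|) * ‖w1‖ +
         (∫ t in (0:ℝ)..T, |∫ s in (0:ℝ)..t, (u2 (θ n) s - v2 s) * y s 3|) * ‖w2‖))
        atTop (𝓝 0) := by
      have := ((l1.mul_const ‖w1‖).add (l2.mul_const ‖w2‖)).const_mul (Real.exp (L * T))
      simpa using this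
    refine squeeze_zero (fun n => intervalIntegral.integral_nonneg hT.le fun _ _ => norm_nonneg _)
      (fun n => ?_) hup
    have hcmp := tb_cmp hF hL (hA (θ n)).1 (hA (θ n)).2.1 (hA (θ n)).2.2.1 (hA (θ n)).2.2.2.1
      hv1 hv2 hv1' hv2' (hxc _) hy (fun t => tb_box_norm hN.le (hxb (θ n) t))
      (fun t => tb_box_norm hN.le (hyb t)) (hA (θ n)).2.2.2.2.2.2 hys
    have hxn := hxc (θ n)
    have hc1 := (c1 n).mul_const ‖w1‖
    have hc2 := (c2 n).mul_const ‖w2‖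
    have hg := tb_gronwall (T := T) (L := L) (f := fun t => ‖x (θ n) t - y t‖)
      (e := fun t => |∫ s in (0:ℝ)..t, (u1 (θ n) s - v1 s) * y s 2| * ‖w1‖ +
        |∫ s in (0:ℝ)..t, (u2 (θ n) s - v2 s) * y s 3| * ‖w2‖) hT.le hL0
      (by fun_prop) (hc1.add hc2) (fun t => by positivity) hcmp
    rw [intervalIntegral.integral_add (hc1.intervalIntegrable _ _) (hc2.intervalIntegrable _ _),
      intervalIntegral.integral_mul_const, intervalIntegral.integral_mul_const] at hg
    exact hg
  have hst : ∀ i : Fin 5, Tendsto (fun n => ∫ t in (0:ℝ)..T, x (θ n) t i) atTop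
      (𝓝 (∫ t in (0:ℝ)..T, y t i)) := by
    intro i
    rw [tendsto_iff_norm_sub_tendsto_zero]
    refine squeeze_zero (fun n => norm_nonneg _) (fun n => ?_) hf0
    have hxn := hxc (θ n)
    rw [← intervalIntegral.integral_sub (Continuous.intervalIntegrable (by fun_prop) _ _)
      (Continuous.intervalIntegrable (by fun_prop) _ _)]
    apply intervalIntegral.norm_integral_le_of_norm_le hT.le
    · exact Eventually.of_forall fun s _ => norm_le_pi_norm (x (θ n) s - y s) i
    · exact Continuous.intervalIntegrable (by fun_prop) _ _
  have hpI : ∀ a b : ℝ → ℝ, Measurable a → Measurable b → (∀ s, a s ∈ Icc (0:ℝ) 1) → 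
      (∀ s, b s ∈ Icc (0:ℝ) 1) → IntervalIntegrable (fun s => a s * b s) volume 0 T := by
    intro a b ha hb ha' hb'
    refine hI _ (ha.mul hb) ⟨1, fun s => ?_⟩ _ _
    rw [Pi.mul_apply, abs_mul]
    have := mul_le_mul (hub a ha' s) (hub b hb' s) (abs_nonneg _) zero_le_one
    linarith
  have hcI : ∀ z : ℝ → Fin 5 → ℝ, Continuous z → ∀ i, IntervalIntegrable (fun s => z s i) volume 0 T :=
    fun z hz i => Continuous.intervalIntegrable (by fun_prop) _ _
  have hcost : ∀ a b z, A a b z → tbCost W1 W2 T a b z = 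
      (∫ t in (0:ℝ)..T, z t 2) + (∫ t in (0:ℝ)..T, z t 3) + W1 / 2 * (∫ t in (0:ℝ)..T, a t * a t)
        + W2 / 2 * (∫ t in (0:ℝ)..T, b t * b t) := by
    rintro a b z ⟨ha, hb, ha', hb', hz, -, -⟩
    have i1 := hcI z hz 2
    have i2 := hcI z hz 3
    have i3 := (hpI a a ha ha ha' ha').const_mul (W1 / 2)
    have i4 := (hpI b b hb hb hb' hb').const_mul (W2 / 2)
    rw [tbCost, ← intervalIntegral.integral_const_mul, ← intervalIntegral.integral_const_mul,
      ← intervalIntegral.integral_add i1 i2, ← intervalIntegral.integral_add (i1.add i2) i3,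
      ← intervalIntegral.integral_add ((i1.add i2).add i3) i4]
    simp only [pow_two]
  have hsq : ∀ a b : ℝ → ℝ, Measurable a → Measurable b → (∀ s, a s ∈ Icc (0:ℝ) 1) → 
      (∀ s, b s ∈ Icc (0:ℝ) 1) → 2 * (∫ t in (0:ℝ)..T, b t * a t) - (∫ t in (0:ℝ)..T, b t * b t)
        ≤ ∫ t in (0:ℝ)..T, a t * a t := by
    intro a b ha hb ha' hb'
    have i1 := hpI a a ha ha ha' ha'
    have i2 := (hpI b a hb ha hb' ha').const_mul 2
    have i3 := hpI b b hb hb hb' hb'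
    rw [← intervalIntegral.integral_const_mul, ← intervalIntegral.integral_sub i2 i3]
    apply intervalIntegral.integral_mono_on hT.le (i2.sub i3) i1
    intro s _
    nlinarith [sq_nonneg (a s - b s)]
  have hlow := (((hst 2).add (hst 3)).add ((((hw1' v1 hv1 ⟨1, hub v1 hv1'⟩).const_mul 2).sub_const
    (∫ t in (0:ℝ)..T, v1 t * v1 t)).const_mul (W1 / 2))).add
      ((((hw2' v2 hv2 ⟨1, hub v2 hv2'⟩).const_mul 2).sub_const
    (∫ t in (0:ℝ)..T, v2 t * v2 t)).const_mul (W2 / 2))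
  have hle := le_of_tendsto_of_tendsto' hlow (hrlim.comp hθm) (fun n => by
    simp only [Function.comp]
    rw [← hJ (θ n), hcost _ _ _ (hA (θ n))]
    have q1 := hsq (u1 (θ n)) v1 (hA _).1 hv1 (hA _).2.2.1 hv1'
    have q2 := hsq (u2 (θ n)) v2 (hA _).2.1 hv2 (hA _).2.2.2.1 hv2'
    gcongr)
  rw [hcost v1 v2 y ⟨hv1, hv2, hv1', hv2', hy, hyb, hys⟩]
  linarith


theorem tb_ok (μ β δ ω ωR σ σR τ0 τ1 τ2 N ε1 ε2 φ : ℝ)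
    (hμ : 0 < μ) (hβ : 0 < β) (hδ : 0 < δ) (hω : 0 < ω) (hωR : 0 < ωR)
    (hσ : 0 < σ) (hσR : 0 < σR) (hτ0 : 0 < τ0) (hτ1 : 0 < τ1) (hτ2 : 0 < τ2)
    (hN : 0 < N) (hε1 : 0 < ε1) (hε2 : 0 < ε2) (hφ : φ ∈ Set.Ioo (0 : ℝ) 1) :
    TbOK N μ (tbRHS μ β δ ω ωR σ σR τ0 τ1 τ2 N ε1 ε2 φ) ![0, 0, -ε1, 0, ε1] ![0, 0, 0, -ε2, ε2] := by
  have hsm : ContDiff ℝ 1 (fun p : (Fin 5 → ℝ) × ℝ × ℝ =>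
      tbRHS μ β δ ω ωR σ σR τ0 τ1 τ2 N ε1 ε2 φ p.1 p.2.1 p.2.2) := by
    rw [contDiff_pi]
    intro i
    fin_cases i <;> simp [tbRHS] <;> fun_prop
  refine ⟨?_, hsm.continuous, ?_, ?_, ?_⟩
  · intro M
    have hc : IsCompact (Metric.closedBall (0 : Fin 5 → ℝ) M ×ˢ (Icc (0:ℝ) 1 ×ˢ Icc (0:ℝ) 1)) :=
      (isCompact_closedBall _ _).prod (isCompact_Icc.prod isCompact_Icc)
    obtain ⟨K, hK⟩ := (hsm.locallyLipschitz.locallyLipschitzOn).exists_lipschitzOnWith_of_compact hc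
    refine ⟨K, K.2, fun x y hx hy a ha b hb => ?_⟩
    have := hK.dist_le_mul (x, a, b) ⟨by simpa using hx, ha, hb⟩ (y, a, b)
      ⟨by simpa using hy, ha, hb⟩
    rw [dist_eq_norm] at this
    refine this.trans_eq ?_
    rw [Prod.dist_eq]
    simp [dist_eq_norm]
  · intro x i hx hi a ha b hb
    have h0 := hx 0
    have h1 := hx 1
    have h2 := hx 2
    have h3 := hx 3
    have h4 := hx 4
    have ha0 := ha.1
    have hb0 := hb.1
    have hφ0 := hφ.1
    have hφ1 : 0 < 1 - φ := sub_pos.2 hφ.2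
    fin_cases i <;> simp [tbRHS] at hi ⊢ <;> rw [hi] <;> simp <;> positivity
  · intro x a b
    simp [tbRHS, Fin.sum_univ_five]
    ring
  · intro x a b c d
    ext i
    fin_cases i <;> simp [tbRHS] <;> ring

/-- The optimal control problem for the TB model admits a
solution: there is an admissible control pair with associated trajectory whose
cost is minimal among all admissible control pairs with associated
trajectories starting from the same initial condition. -/
theorem tb_optimal_control_exists
    (μ β δ ω ωR σ σR τ0 τ1 τ2 N ε1 ε2 φ W1 W2 : ℝ)
    (hμ : 0 < μ) (hβ : 0 < β) (hδ : 0 < δ) (hω : 0 < ω) (hωR : 0 < ωR)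
    (hσ : 0 < σ) (hσR : 0 < σR) (hτ0 : 0 < τ0) (hτ1 : 0 < τ1) (hτ2 : 0 < τ2)
    (hN : 0 < N) (hε1 : 0 < ε1) (hε2 : 0 < ε2) (hφ : φ ∈ Set.Ioo (0 : ℝ) 1)
    (hW1 : 0 < W1) (hW2 : 0 < W2)
    (T : ℝ) (hT : 0 < T)
    (x₀ : Fin 5 → ℝ) (hx₀ : ∀ i, 0 ≤ x₀ i)
    (hx₀sum : x₀ 0 + x₀ 1 + x₀ 2 + x₀ 3 + x₀ 4 = N) :
    ∃ (u1s u2s : ℝ → ℝ) (xs : ℝ → Fin 5 → ℝ),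
      IsAdmissible T u1s u2s ∧
      IsTrajectory μ β δ ω ωR σ σR τ0 τ1 τ2 N ε1 ε2 φ T x₀ u1s u2s xs ∧
      ∀ (u1 u2 : ℝ → ℝ) (x : ℝ → Fin 5 → ℝ),
        IsAdmissible T u1 u2 →
        IsTrajectory μ β δ ω ωR σ σR τ0 τ1 τ2 N ε1 ε2 φ T x₀ u1 u2 x →
        tbCost W1 W2 T u1s u2s xs ≤ tbCost W1 W2 T u1 u2 x := by
  obtain ⟨v1, v2, y, h1, h2, h3, h4, h5, h6, h7⟩ := tb_abs hN hμ
    (tb_ok μ β δ ω ωR σ σR τ0 τ1 τ2 N ε1 ε2 φ hμ hβ hδ hω hωR hσ hσR hτ0 hτ1 hτ2 hN hε1 hε2 hφ)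
    hT x₀ hx₀ (by rw [Fin.sum_univ_five]; exact hx₀sum) hW1 hW2
  refine ⟨v1, v2, y, ⟨h1, h2, fun t _ => ⟨h3 t, h4 t⟩⟩, ⟨h5.continuousOn, h6⟩, ?_⟩
  rintro u1 u2 x ⟨a1, a2, a3⟩ ⟨b1, b2⟩
  exact h7 u1 u2 x a1 a2 a3 b1 b2
end

section
/- Fix a final time T > 0 and an initial condition x₀ = (S₀, L1₀, I₀, L2₀, R₀) ∈ ℝ⁵ with all entries nonnegative and summing to N. Suppose (u1*, u2*) is an optimal admissible control pair on [0,T] with associated trajectory (S*, L1*, I*, L2*, R*), i.e., it minimizes the cost functional J over all admissible control pairs with trajectories starting from x₀. Then there exist absolutely continuous adjoint functions λ1*, λ2*, λ3*, λ4*, λ5* : [0,T] → ℝ satisfying the adjoint system (with the optimal state and controls substituted) almost everywhere on [0,T], together with the transversality conditions λᵢ*(T) = 0 for i = 1, …, 5, and such that for almost every t ∈ [0,T]: u1*(t) = min{ max{0, ε1·I*(t)·(λ3*(t) − λ5*(t)) / W1}, 1} and u2*(t) = min{ max{0, ε2·L2*(t)·(λ4*(t) − λ5*(t)) / W2}, 1}.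 -/
/-- The right-hand side of the adjoint system: given state value
`x = (S*, L₁*, I*, L₂*, R*)`, control values `u₁*, u₂*` and adjoint value
`l = (λ₁, λ₂, λ₃, λ₄, λ₅)`, it returns `(λ₁', λ₂', λ₃', λ₄', λ₅')`. -/
noncomputable def tbAdjRHS (μ β δ ω ωR σ σR τ0 τ1 τ2 N ε1 ε2 φ : ℝ)
    (x : Fin 5 → ℝ) (u1 u2 : ℝ) (l : Fin 5 → ℝ) : Fin 5 → ℝ :=
  ![l 0 * (β / N * x 2 + μ) - l 1 * (β / N * x 2),
    l 1 * (δ + τ1 + μ) - l 2 * (φ * δ) - l 3 * ((1 - φ) * δ) - l 4 * τ1,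
    -1 + l 0 * (β / N * x 0) - l 1 * (β / N * (x 0 + σ * x 3 + σR * x 4))
      + l 2 * (τ0 + ε1 * u1 + μ) + l 3 * (σ * (β / N) * x 3)
      - l 4 * (τ0 + ε1 * u1 - σR * (β / N) * x 4),
    -1 - l 1 * (β / N * x 2 * σ) - l 2 * ω
      + l 3 * (σ * (β / N) * x 2 + ω + ε2 * u2 + τ2 + μ) - l 4 * (τ2 + ε2 * u2),
    -(l 1 * (σR * (β / N) * x 2)) - l 2 * ωR
      + l 4 * (σR * (β / N) * x 2 + ωR + μ)]

open MeasureTheory Set in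
theorem tbaux_ibp (T : ℝ) (g k : ℝ → ℝ) (hg : IntervalIntegrable g volume 0 T)
    (hk : IntervalIntegrable k volume 0 T) :
    ∫ t in (0:ℝ)..T, ((-∫ s in t..T, g s) * k t + g t * (∫ s in (0:ℝ)..t, k s)) = 0 := by
  have h1 := hg.absolutelyContinuousOnInterval_intervalIntegral (c := T) (by simp)
  have h2 := hk.absolutelyContinuousOnInterval_intervalIntegral (c := 0) (by simp)
  have h := h1.integral_deriv_mul_eq_sub h2
  simp only [intervalIntegral.integral_same, zero_mul, mul_zero, sub_zero] at h
  refine Eq.trans ?_ h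
  apply intervalIntegral.integral_congr_ae
  filter_upwards [hg.ae_hasDerivAt_integral, hk.ae_hasDerivAt_integral] with x hx1 hx2 hx3
  have hx4 : x ∈ uIcc 0 T := uIoc_subset_uIcc hx3
  rw [(hx1 hx4 T (by simp)).deriv, (hx2 hx4 0 (by simp)).deriv,
    ← intervalIntegral.integral_symm]
  ring

open MeasureTheory Set in
theorem tbaux_integrable {P E : Type*} [TopologicalSpace P] [MeasurableSpace P] [BorelSpace P]
    [NormedAddCommGroup E] [MeasurableSpace E] [BorelSpace E] [SecondCountableTopology E]
    (T : ℝ) (hT : 0 ≤ T) (H : P → E) (hH : Continuous H) (p : ℝ → P) (hp : Measurable p)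
    (C : Set P) (hC : IsCompact C) (hpC : ∀ s ∈ Icc 0 T, p s ∈ C) :
    IntervalIntegrable (fun s => H (p s)) volume 0 T := by
  obtain ⟨B, hB⟩ := hC.exists_bound_of_continuousOn hH.continuousOn
  rw [intervalIntegrable_iff_integrableOn_Ioc_of_le hT]
  refine Measure.integrableOn_of_bounded (M := B) (by simp) ?_ ?_
  · exact (hH.measurable.comp hp).stronglyMeasurable.aestronglyMeasurable
  · refine (ae_restrict_iff' measurableSet_Ioc).2 (Filter.Eventually.of_forall ?_)
    intro s hs
    exact hB _ (hpC s ⟨hs.1.le, hs.2⟩)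

open MeasureTheory Set in
theorem tbaux_picard {E : Type*} [NormedAddCommGroup E] [NormedSpace ℝ E] [CompleteSpace E]
    (T : ℝ) (hT : 0 ≤ T) (K : ℝ) (hK : 0 < K) (f : ℝ → E → E)
    (hLip : ∀ s ∈ Icc 0 T, ∀ x y, ‖f s x - f s y‖ ≤ K * ‖x - y‖)
    (hint : ∀ x : ℝ → E, Continuous x → IntervalIntegrable (fun s => f s (x s)) volume 0 T)
    (x0 : E) (z : ℝ → E) (hz : Continuous z) (D : ℝ)
    (hD : ∀ t ∈ Icc 0 T, ‖x0 + (∫ s in (0:ℝ)..t, f s (z s)) - z t‖ ≤ D) :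
    ∃ x : ℝ → E, Continuous x ∧
      ∀ t ∈ Icc 0 T, x t = x0 + (∫ s in (0:ℝ)..t, f s (x s)) ∧
        ‖x t - z t‖ ≤ 2 * Real.exp (2 * K * T) * D := by
  let up : C(Icc (0:ℝ) T, E) → ℝ → E := fun y s => Real.exp (2 * K * s) • IccExtend hT y s
  have hup : ∀ y, Continuous (up y) := fun y =>
    (by fun_prop : Continuous fun s : ℝ => Real.exp (2 * K * s)).smul y.continuous.Icc_extend'
  have hint' : ∀ x : ℝ → E, Continuous x → ∀ t ∈ Icc 0 T,
      IntervalIntegrable (fun s => f s (x s)) volume 0 t := by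
    intro x hx t ht
    refine (hint x hx).mono_set ?_
    rw [uIcc_of_le ht.1, uIcc_of_le hT]
    exact Icc_subset_Icc le_rfl ht.2
  have hc : ∀ y : C(Icc (0:ℝ) T, E), Continuous fun t : Icc (0:ℝ) T =>
      Real.exp (-(2 * K * t)) • (x0 + ∫ s in (0:ℝ)..t, f s (up y s)) := by
    intro y
    have h1 := intervalIntegral.continuousOn_primitive_interval' (hint _ (hup y))
      (a := 0) (by simp)
    rw [uIcc_of_le hT] at h1
    have h2 := continuousOn_iff_continuous_domRestrict.1 h1
    exact (by fun_prop : Continuous fun t : Icc (0:ℝ) T => Real.exp (-(2 * K * t))).smul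
      (continuous_const.add h2)
  let Φ : C(Icc (0:ℝ) T, E) → C(Icc (0:ℝ) T, E) := fun y => ⟨_, hc y⟩
  have hexp : ∀ t : ℝ, ∫ s in (0:ℝ)..t, Real.exp (2 * K * s) =
      (Real.exp (2 * K * t) - 1) / (2 * K) := by
    intro t
    rw [intervalIntegral.integral_comp_mul_left (fun x => Real.exp x) (by positivity)]
    simp [integral_exp, div_eq_inv_mul]
  have hΦ : ContractingWith (1/2) Φ := by
    refine ⟨by
      rw [← NNReal.coe_lt_coe]; norm_num, LipschitzWith.of_dist_le_mul ?_⟩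
    intro y w
    rw [ContinuousMap.dist_le (by positivity)]
    intro t
    have hd : ∀ s, ‖up y s - up w s‖ ≤ Real.exp (2 * K * s) * dist y w := by
      intro s
      simp only [up]
      rw [← smul_sub, norm_smul, Real.norm_eq_abs, abs_of_pos (Real.exp_pos _), ← dist_eq_norm]
      exact mul_le_mul_of_nonneg_left (ContinuousMap.dist_apply_le_dist _) (Real.exp_pos _).le
    have hb : ‖(∫ s in (0:ℝ)..t, f s (up y s)) - ∫ s in (0:ℝ)..t, f s (up w s)‖ ≤
        ∫ s in (0:ℝ)..t, K * dist y w * Real.exp (2 * K * s) := by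
      rw [← intervalIntegral.integral_sub (hint' _ (hup y) t t.2) (hint' _ (hup w) t t.2)]
      refine intervalIntegral.norm_integral_le_of_norm_le t.2.1 ?_ ?_
      · refine Filter.Eventually.of_forall fun s hs => ?_
        refine (hLip s ⟨hs.1.le, hs.2.trans t.2.2⟩ _ _).trans ?_
        nlinarith [hd s]
      · exact Continuous.intervalIntegrable (by fun_prop) _ _
    rw [intervalIntegral.integral_const_mul, hexp] at hb
    change dist (Real.exp (-(2 * K * t)) • (x0 + ∫ s in (0:ℝ)..t, f s (up y s)))
      (Real.exp (-(2 * K * t)) • (x0 + ∫ s in (0:ℝ)..t, f s (up w s))) ≤ _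
    rw [dist_eq_norm, ← smul_sub, norm_smul, Real.norm_eq_abs, abs_of_pos (Real.exp_pos _),
      add_sub_add_left_eq_sub]
    refine (mul_le_mul_of_nonneg_left hb (Real.exp_pos _).le).trans ?_
    have he : Real.exp (-(2 * K * t)) * Real.exp (2 * K * t) = 1 := by
      rw [← Real.exp_add]; simp
    have : Real.exp (-(2 * K * t)) * (K * dist y w * ((Real.exp (2 * K * t) - 1) / (2 * K)))
        = (1/2) * dist y w * (1 - Real.exp (-(2 * K * t))) := by
      field_simp
      linear_combination dist y w * he
    rw [this]
    have h0 : 0 ≤ dist y w := dist_nonneg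
    have h1 : 0 < Real.exp (-(2 * K * t)) := Real.exp_pos _
    push_cast
    nlinarith
  let z' : C(Icc (0:ℝ) T, E) := ⟨fun t => Real.exp (-(2 * K * t)) • z t, by fun_prop⟩
  have hfix : Φ (hΦ.fixedPoint Φ) = hΦ.fixedPoint Φ := hΦ.fixedPoint_isFixedPt
  have hdist := hΦ.dist_fixedPoint_le z'
  set y := hΦ.fixedPoint Φ
  have hee : ∀ t : ℝ, Real.exp (2 * K * t) * Real.exp (-(2 * K * t)) = 1 := by
    intro t; rw [← Real.exp_add]; simp
  refine ⟨up y, hup y, fun t ht => ⟨?_, ?_⟩⟩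
  · have h1 : y ⟨t, ht⟩ = Real.exp (-(2 * K * t)) • (x0 + ∫ s in (0:ℝ)..t, f s (up y s)) := by
      conv_lhs => rw [← hfix]
      rfl
    change Real.exp (2 * K * t) • IccExtend hT y t = _
    rw [IccExtend_of_mem _ _ ht, h1, smul_smul, hee, one_smul]
  · have hD0 : 0 ≤ D := (norm_nonneg _).trans (hD t ht)
    have hz' : dist z' (Φ z') ≤ D := by
      rw [ContinuousMap.dist_le hD0]
      intro r
      have hupz : ∀ s ∈ Icc 0 T, up z' s = z s := by
        intro s hs
        change Real.exp (2 * K * s) • IccExtend hT z' s = _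
        rw [IccExtend_of_mem _ _ hs]
        change Real.exp (2 * K * s) • (Real.exp (-(2 * K * s)) • z s) = _
        rw [smul_smul, hee, one_smul]
      change dist (Real.exp (-(2 * K * r)) • z r)
        (Real.exp (-(2 * K * r)) • (x0 + ∫ s in (0:ℝ)..r, f s (up z' s))) ≤ _
      rw [dist_comm, dist_eq_norm, ← smul_sub, norm_smul, Real.norm_eq_abs,
        abs_of_pos (Real.exp_pos _)]
      have : ∫ s in (0:ℝ)..r, f s (up z' s) = ∫ s in (0:ℝ)..r, f s (z s) := by
        apply intervalIntegral.integral_congr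
        intro s hs
        rw [uIcc_of_le r.2.1] at hs
        simp only
        rw [hupz s ⟨hs.1, hs.2.trans r.2.2⟩]
      rw [this]
      have h1 : Real.exp (-(2 * K * r)) ≤ 1 := by
        rw [Real.exp_le_one_iff]
        have := r.2.1
        have : 0 ≤ 2 * K * r := by positivity
        linarith
      calc _ ≤ 1 * D := mul_le_mul h1 (hD r r.2) (norm_nonneg _) zero_le_one
        _ = D := one_mul D
    have h2 : dist z' y ≤ 2 * D := by
      refine hdist.trans ?_
      push_cast
      norm_num
      linarith
    have h3 : ‖y ⟨t, ht⟩ - Real.exp (-(2 * K * t)) • z t‖ ≤ 2 * D := by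
      rw [← dist_eq_norm, dist_comm]
      exact (ContinuousMap.dist_apply_le_dist (f := z') (g := y) ⟨t, ht⟩).trans h2
    have h4 : up y t - z t = Real.exp (2 * K * t) • (y ⟨t, ht⟩ - Real.exp (-(2 * K * t)) • z t) := by
      change Real.exp (2 * K * t) • IccExtend hT y t - z t = _
      rw [IccExtend_of_mem _ _ ht, smul_sub, smul_smul, hee, one_smul]
    rw [h4, norm_smul, Real.norm_eq_abs, abs_of_pos (Real.exp_pos _)]
    have h5 : Real.exp (2 * K * t) ≤ Real.exp (2 * K * T) := by
      apply Real.exp_le_exp.2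
      have := ht.2
      gcongr
    calc _ ≤ Real.exp (2 * K * T) * (2 * D) :=
          mul_le_mul h5 h3 (norm_nonneg _) (Real.exp_pos _).le
      _ = _ := by ring

section TBAux

variable (μ β δ ω ωR σ σR τ0 τ1 τ2 N ε1 ε2 φ : ℝ)

theorem tbaux_contDiff : ContDiff ℝ 1 (fun p : (Fin 5 → ℝ) × ℝ × ℝ =>
    tbRHS μ β δ ω ωR σ σR τ0 τ1 τ2 N ε1 ε2 φ p.1 p.2.1 p.2.2) := by
  rw [contDiff_pi]
  intro i
  fin_cases i <;> simp [tbRHS] <;> fun_prop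

theorem tbaux_adj_cont : Continuous (fun p : ((Fin 5 → ℝ) × ℝ × ℝ) × (Fin 5 → ℝ) =>
    tbAdjRHS μ β δ ω ωR σ σR τ0 τ1 τ2 N ε1 ε2 φ p.1.1 p.1.2.1 p.1.2.2 p.2) := by
  rw [continuous_pi_iff]
  intro i
  fin_cases i <;> simp [tbAdjRHS] <;> fun_prop

theorem tbaux_adj_lin (x m w : Fin 5 → ℝ) (a b r : ℝ) :
    tbAdjRHS μ β δ ω ωR σ σR τ0 τ1 τ2 N ε1 ε2 φ x a b (m + r • w)
      - tbAdjRHS μ β δ ω ωR σ σR τ0 τ1 τ2 N ε1 ε2 φ x a b m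
    = r • (tbAdjRHS μ β δ ω ωR σ σR τ0 τ1 τ2 N ε1 ε2 φ x a b w
      - tbAdjRHS μ β δ ω ωR σ σR τ0 τ1 τ2 N ε1 ε2 φ x a b 0) := by
  ext i
  fin_cases i <;> simp [tbAdjRHS] <;> ring

/-- quadratic remainder -/
noncomputable def tbauxQ (p : (Fin 5 → ℝ) × (Fin 5 → ℝ) × ℝ × ℝ) : ℝ :=
  p.1 0 * (-(β / N) * p.2.1 2 * p.2.1 0)
  + p.1 1 * (β / N * p.2.1 2 * (p.2.1 0 + σ * p.2.1 3 + σR * p.2.1 4))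
  + p.1 2 * (- ε1 * p.2.2.1 * p.2.1 2)
  + p.1 3 * (- σ * (β / N) * p.2.1 2 * p.2.1 3 - ε2 * p.2.2.2 * p.2.1 3)
  + p.1 4 * (ε1 * p.2.2.1 * p.2.1 2 + ε2 * p.2.2.2 * p.2.1 3
    - σR * (β / N) * p.2.1 2 * p.2.1 4)

theorem tbauxQ_cont : Continuous (tbauxQ β σ σR N ε1 ε2) := by
  unfold tbauxQ
  fun_prop

theorem tbaux_identity (x y l d : Fin 5 → ℝ) (a b e1 e2 h : ℝ) (hy : y = x + h • d) :
    ∑ i, (l i * (tbRHS μ β δ ω ωR σ σR τ0 τ1 τ2 N ε1 ε2 φ y (a + h * e1) (b + h * e2) i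
        - tbRHS μ β δ ω ωR σ σR τ0 τ1 τ2 N ε1 ε2 φ x a b i)
      + tbAdjRHS μ β δ ω ωR σ σR τ0 τ1 τ2 N ε1 ε2 φ x a b l i * (y i - x i))
    = -(y 2 - x 2) - (y 3 - x 3) - h * (ε1 * e1 * x 2 * (l 2 - l 4))
      - h * (ε2 * e2 * x 3 * (l 3 - l 4))
      + h ^ 2 * tbauxQ β σ σR N ε1 ε2 (l, d, e1, e2) := by
  subst hy
  simp [Fin.sum_univ_five, tbRHS, tbAdjRHS, tbauxQ]
  ring

open MeasureTheory Set in
theorem tbaux_adjoint (T : ℝ) (hT : 0 < T) (u1 u2 : ℝ → ℝ) (hadm : IsAdmissible T u1 u2)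
    (X : ℝ → Fin 5 → ℝ) (hX : Continuous X) :
    ∃ l : ℝ → Fin 5 → ℝ, Continuous l ∧ ∀ t ∈ Icc 0 T,
      l t = -∫ s in t..T, tbAdjRHS μ β δ ω ωR σ σR τ0 τ1 τ2 N ε1 ε2 φ
        (X s) (u1 s) (u2 s) (l s) := by
  obtain ⟨hm1, hm2, hu⟩ := hadm
  set G := fun p : ((Fin 5 → ℝ) × ℝ × ℝ) × (Fin 5 → ℝ) =>
    tbAdjRHS μ β δ ω ωR σ σR τ0 τ1 τ2 N ε1 ε2 φ p.1.1 p.1.2.1 p.1.2.2 p.2 with hG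
  have hGc : Continuous G := tbaux_adj_cont μ β δ ω ωR σ σR τ0 τ1 τ2 N ε1 ε2 φ
  have hXc : IsCompact (X '' Icc 0 T) := isCompact_Icc.image hX
  have hPc : IsCompact ((X '' Icc 0 T) ×ˢ (Icc (0:ℝ) 1 ×ˢ Icc (0:ℝ) 1)) :=
    hXc.prod (isCompact_Icc.prod isCompact_Icc)
  have hrev : ∀ s ∈ Icc 0 T, T - s ∈ Icc 0 T := fun s hs => ⟨by linarith [hs.2], by linarith [hs.1]⟩
  have hP : ∀ s ∈ Icc 0 T, (X s, u1 s, u2 s) ∈ (X '' Icc 0 T) ×ˢ (Icc (0:ℝ) 1 ×ˢ Icc (0:ℝ) 1) :=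
    fun s hs => ⟨mem_image_of_mem _ hs, hu s hs⟩
  obtain ⟨B, hB⟩ := (hPc.prod (isCompact_closedBall (0 : Fin 5 → ℝ) 1)).exists_bound_of_continuousOn
    hGc.continuousOn
  have hLip : ∀ s ∈ Icc 0 T, ∀ x y : Fin 5 → ℝ,
      ‖G ((X s, u1 s, u2 s), x) - G ((X s, u1 s, u2 s), y)‖ ≤ (2 * |B| + 1) * ‖x - y‖ := by
    intro s hs x y
    by_cases hxy : x = y
    · subst hxy; simp
    have hr : 0 < ‖x - y‖ := norm_pos_iff.2 (sub_ne_zero.2 hxy)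
    set w := ‖x - y‖⁻¹ • (x - y)
    have hw : ‖w‖ ≤ 1 := by
      rw [norm_smul, norm_inv, norm_norm, inv_mul_cancel₀ hr.ne']
    have hx : x = y + ‖x - y‖ • w := by
      rw [smul_smul, mul_inv_cancel₀ hr.ne', one_smul]; abel
    have h1 : G ((X s, u1 s, u2 s), x) - G ((X s, u1 s, u2 s), y) =
        ‖x - y‖ • (G ((X s, u1 s, u2 s), w) - G ((X s, u1 s, u2 s), 0)) := by
      conv_lhs => rw [hx]
      exact tbaux_adj_lin μ β δ ω ωR σ σR τ0 τ1 τ2 N ε1 ε2 φ _ _ _ _ _ _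
    rw [h1, norm_smul, norm_norm, mul_comm]
    refine mul_le_mul_of_nonneg_right ?_ hr.le
    have h2 := hB ((X s, u1 s, u2 s), w) ⟨hP s hs, by simpa using hw⟩
    have h3 := hB ((X s, u1 s, u2 s), 0) ⟨hP s hs, by simp⟩
    have := le_abs_self B
    exact (norm_sub_le _ _).trans (by linarith)
  have hint : ∀ x : ℝ → Fin 5 → ℝ, Continuous x → IntervalIntegrable
      (fun s => -G ((X (T - s), u1 (T - s), u2 (T - s)), x s)) volume 0 T := by
    intro x hx
    refine tbaux_integrable T hT.le (fun p => - G p) hGc.neg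
      (fun s => ((X (T - s), u1 (T - s), u2 (T - s)), x s)) ?_ _
      (hPc.prod ((isCompact_Icc (a := 0) (b := T)).image hx)) ?_
    · have hs : Measurable fun s : ℝ => T - s := by fun_prop
      exact ((hX.measurable.comp hs).prodMk ((hm1.comp hs).prodMk (hm2.comp hs))).prodMk
        hx.measurable
    · intro s hs
      exact ⟨hP _ (hrev s hs), mem_image_of_mem _ hs⟩
  obtain ⟨m, hm, hm'⟩ := tbaux_picard T hT.le (2 * |B| + 1) (by positivity)
    (fun s x => -G ((X (T - s), u1 (T - s), u2 (T - s)), x))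
    (by
      intro s hs x y
      rw [neg_sub_neg, norm_sub_rev]
      exact hLip _ (hrev s hs) x y)
    hint 0 (fun _ => 0) continuous_const (|B| * T) (by
      intro t ht
      rw [zero_add, sub_zero]
      refine (intervalIntegral.norm_integral_le_of_norm_le_const (C := |B|) ?_).trans ?_
      · intro s hs
        rw [uIoc_of_le ht.1] at hs
        rw [norm_neg]
        exact (hB _ ⟨hP _ (hrev s ⟨hs.1.le, hs.2.trans ht.2⟩), by simp⟩).trans (le_abs_self B)
      · rw [sub_zero, abs_of_nonneg ht.1]
        exact mul_le_mul_of_nonneg_left ht.2 (abs_nonneg _))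
  refine ⟨fun t => m (T - t), by fun_prop, fun t ht => ?_⟩
  simp only
  rw [(hm' _ (hrev t ht)).1, zero_add, intervalIntegral.integral_neg]
  have := intervalIntegral.integral_comp_sub_left (a := t) (b := T)
    (fun s => G ((X (T - s), u1 (T - s), u2 (T - s)), m s)) T
  simp only [sub_self, sub_sub_cancel] at this
  rw [← this]

open MeasureTheory Set in
theorem tbaux_perturb (T : ℝ) (hT : 0 < T) (u1 u2 v1 v2 : ℝ → ℝ) (hu : IsAdmissible T u1 u2)
    (hv : IsAdmissible T v1 v2)
    (X : ℝ → Fin 5 → ℝ) (hX : Continuous X) (x₀ : Fin 5 → ℝ)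
    (htr : IsTrajectory μ β δ ω ωR σ σR τ0 τ1 τ2 N ε1 ε2 φ T x₀ u1 u2 X) :
    ∃ C h₀ : ℝ, 0 < h₀ ∧ ∀ h, 0 < h → h ≤ h₀ →
      IsAdmissible T (fun s => u1 s + h * (v1 s - u1 s)) (fun s => u2 s + h * (v2 s - u2 s)) ∧
      ∃ x : ℝ → Fin 5 → ℝ, Continuous x ∧
        IsTrajectory μ β δ ω ωR σ σR τ0 τ1 τ2 N ε1 ε2 φ T x₀
          (fun s => u1 s + h * (v1 s - u1 s)) (fun s => u2 s + h * (v2 s - u2 s)) x ∧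
        ∀ t ∈ Icc 0 T, ‖x t - X t‖ ≤ C * h := by
  set F := fun p : (Fin 5 → ℝ) × ℝ × ℝ =>
    tbRHS μ β δ ω ωR σ σR τ0 τ1 τ2 N ε1 ε2 φ p.1 p.2.1 p.2.2 with hF
  have hFc : ContDiff ℝ 1 F := tbaux_contDiff μ β δ ω ωR σ σR τ0 τ1 τ2 N ε1 ε2 φ
  obtain ⟨B, hB⟩ := isCompact_Icc.exists_bound_of_continuousOn (s := Icc 0 T) hX.continuousOn
  have hB0 : 0 ≤ B := (norm_nonneg _).trans (hB 0 ⟨le_rfl, hT.le⟩)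
  set M := B + 1 with hM
  have hM0 : 0 < M := by positivity
  -- clamp
  let cl : (Fin 5 → ℝ) → (Fin 5 → ℝ) := fun x i => max (-M) (min M (x i))
  have hclc : Continuous cl := by
    rw [continuous_pi_iff]; intro i; fun_prop
  have hclb : ∀ x, ‖cl x‖ ≤ M := by
    intro x
    rw [pi_norm_le_iff_of_nonneg hM0.le]
    intro i
    rw [Real.norm_eq_abs, abs_le]
    exact ⟨le_max_left _ _, max_le (by linarith) (min_le_left _ _)⟩
  have hcll : ∀ x y, ‖cl x - cl y‖ ≤ ‖x - y‖ := by
    intro x y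
    rw [pi_norm_le_iff_of_nonneg (norm_nonneg _)]
    intro i
    have h1 : |max (-M) (min M (x i)) - max (-M) (min M (y i))| ≤ |x i - y i| := by
      refine (abs_max_sub_max_le_max _ _ _ _).trans ?_
      rw [sub_self, abs_zero]
      refine max_le (abs_nonneg _) ((abs_min_sub_min_le_max _ _ _ _).trans ?_)
      rw [sub_self, abs_zero]
      exact max_le (abs_nonneg _) le_rfl
    exact h1.trans (norm_le_pi_norm (x - y) i)
  have hcle : ∀ x, ‖x‖ ≤ M → cl x = x := by
    intro x hx
    ext i
    have h1 := (norm_le_pi_norm x i).trans hx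
    rw [Real.norm_eq_abs, abs_le] at h1
    simp only [cl]
    rw [min_eq_right h1.2, max_eq_right h1.1]
  set Q : Set ((Fin 5 → ℝ) × ℝ × ℝ) := Metric.closedBall 0 M ×ˢ (Icc (0:ℝ) 1 ×ˢ Icc (0:ℝ) 1)
  have hQc : IsCompact Q := (isCompact_closedBall _ _).prod (isCompact_Icc.prod isCompact_Icc)
  have hQv : Convex ℝ Q := (convex_closedBall _ _).prod ((convex_Icc _ _).prod (convex_Icc _ _))
  obtain ⟨K', hK'⟩ := hFc.contDiffOn.exists_lipschitzOnWith (s := Q) one_ne_zero hQv hQc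
  set K : ℝ := K' + 1 with hK
  have hK0 : 0 < K := by positivity
  have hLF : ∀ p ∈ Q, ∀ q ∈ Q, ‖F p - F q‖ ≤ K * ‖p - q‖ := by
    intro p hp q hq
    have := hK'.dist_le_mul p hp q hq
    rw [dist_eq_norm, dist_eq_norm] at this
    nlinarith [norm_nonneg (p - q)]
  refine ⟨2 * Real.exp (2 * K * T) * (K * T),
    min 1 (1 / (2 * Real.exp (2 * K * T) * (K * T))), by positivity, fun h h0 hle => ?_⟩
  have hle1 : h ≤ 1 := hle.trans (min_le_left _ _)
  have hle2 : 2 * Real.exp (2 * K * T) * (K * T) * h ≤ 1 := by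
    have := hle.trans (min_le_right _ _)
    rwa [le_div_iff₀ (by positivity), mul_comm] at this
  obtain ⟨hm1, hm2, hu'⟩ := hu
  obtain ⟨hn1, hn2, hv'⟩ := hv
  have hadm : IsAdmissible T (fun s => u1 s + h * (v1 s - u1 s))
      (fun s => u2 s + h * (v2 s - u2 s)) := by
    refine ⟨by fun_prop, by fun_prop, fun t ht => ?_⟩
    obtain ⟨⟨a1, a2⟩, a3, a4⟩ := hu' t ht
    obtain ⟨⟨b1, b2⟩, b3, b4⟩ := hv' t ht
    refine ⟨⟨?_, ?_⟩, ?_, ?_⟩ <;> simp only <;> nlinarith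
  refine ⟨hadm, ?_⟩
  obtain ⟨hw1, hw2, hw'⟩ := hadm
  set w1 := fun s => u1 s + h * (v1 s - u1 s) with hw1d
  set w2 := fun s => u2 s + h * (v2 s - u2 s) with hw2d
  have hQ : ∀ s ∈ Icc 0 T, ∀ x, (cl x, w1 s, w2 s) ∈ Q := by
    intro s hs x
    exact ⟨by simpa using hclb x, hw' s hs⟩
  have hXM : ∀ s ∈ Icc 0 T, ‖X s‖ ≤ M := fun s hs => (hB s hs).trans (by linarith)
  have hQu : ∀ s ∈ Icc 0 T, (X s, u1 s, u2 s) ∈ Q := by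
    intro s hs
    exact ⟨by simpa using hXM s hs, hu' s hs⟩
  have hint : ∀ x : ℝ → Fin 5 → ℝ, Continuous x → IntervalIntegrable
      (fun s => F (cl (x s), w1 s, w2 s)) volume 0 T := by
    intro x hx
    refine tbaux_integrable T hT.le F hFc.continuous (fun s => (cl (x s), w1 s, w2 s)) ?_ Q hQc
      (fun s hs => hQ s hs _)
    exact (hclc.comp hx).measurable.prodMk (hw1.prodMk hw2)
  have hintu : IntervalIntegrable (fun s => F (X s, u1 s, u2 s)) volume 0 T :=
    tbaux_integrable T hT.le F hFc.continuous (fun s => (X s, u1 s, u2 s))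
      (hX.measurable.prodMk (hm1.prodMk hm2)) Q hQc hQu
  obtain ⟨x, hxc, hx⟩ := tbaux_picard T hT.le K hK0 (fun s x => F (cl x, w1 s, w2 s))
    (by
      intro s hs x y
      refine (hLF _ (hQ s hs x) _ (hQ s hs y)).trans ?_
      refine mul_le_mul_of_nonneg_left ?_ hK0.le
      simpa [Prod.norm_def] using hcll x y)
    hint x₀ X hX (K * T * h) (by
      intro t ht
      have hsub : uIcc 0 t ⊆ uIcc 0 T := by
        rw [uIcc_of_le ht.1, uIcc_of_le hT.le]
        exact Icc_subset_Icc le_rfl ht.2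
      have e1 : X t = x₀ + ∫ s in (0:ℝ)..t, F (X s, u1 s, u2 s) := htr.2 t ht
      conv_lhs => rw [e1]
      rw [add_sub_add_left_eq_sub, ← intervalIntegral.integral_sub
        ((hint X hX).mono_set hsub) (hintu.mono_set hsub)]
      refine (intervalIntegral.norm_integral_le_of_norm_le_const (C := K * h) ?_).trans ?_
      · intro s hs
        rw [uIoc_of_le ht.1] at hs
        have hs' : s ∈ Icc 0 T := ⟨hs.1.le, hs.2.trans ht.2⟩
        refine (hLF _ (hQ s hs' _) _ (hQu s hs')).trans ?_
        refine mul_le_mul_of_nonneg_left ?_ hK0.le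
        rw [hcle _ (hXM s hs')]
        obtain ⟨⟨a1, a2⟩, a3, a4⟩ := hu' s hs'
        obtain ⟨⟨b1, b2⟩, b3, b4⟩ := hv' s hs'
        simp only [Prod.norm_def, Prod.mk_sub_mk, sub_self, norm_zero, hw1d, hw2d,
          add_sub_cancel_left, Real.norm_eq_abs]
        refine max_le h0.le (max_le ?_ ?_) <;> rw [abs_le] <;> constructor <;> nlinarith
      · rw [sub_zero, abs_of_nonneg ht.1]
        have := mul_le_mul_of_nonneg_left ht.2 (mul_pos hK0 h0).le
        linarith)
  have hb : ∀ t ∈ Icc 0 T, ‖x t - X t‖ ≤ 2 * Real.exp (2 * K * T) * (K * T) * h := by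
    intro t ht
    exact (hx t ht).2.trans (le_of_eq (by ring))
  have hxM : ∀ t ∈ Icc 0 T, ‖x t‖ ≤ M := by
    intro t ht
    have h1 := norm_le_norm_add_norm_sub (X t) (x t)
    rw [norm_sub_rev] at h1
    linarith [hb t ht, hB t ht]
  refine ⟨x, hxc, ⟨hxc.continuousOn, ?_⟩, hb⟩
  intro t ht
  rw [(hx t ht).1]
  congr 1
  apply intervalIntegral.integral_congr
  intro s hs
  rw [uIcc_of_le ht.1] at hs
  simp only
  rw [hcle _ (hxM s ⟨hs.1, hs.2.trans ht.2⟩)]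

end TBAux

open MeasureTheory Set in
theorem tbaux_int_adm {E : Type*} [NormedAddCommGroup E] [MeasurableSpace E] [BorelSpace E]
    [SecondCountableTopology E]
    (T : ℝ) (hT : 0 ≤ T) (u1 u2 : ℝ → ℝ) (hadm : IsAdmissible T u1 u2)
    (X l : ℝ → Fin 5 → ℝ) (hX : Continuous X) (hl : Continuous l)
    (H : ((Fin 5 → ℝ) × ℝ × ℝ) × (Fin 5 → ℝ) → E) (hH : Continuous H) :
    IntervalIntegrable (fun s => H ((X s, u1 s, u2 s), l s)) volume 0 T := by
  obtain ⟨hm1, hm2, hu⟩ := hadm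
  refine tbaux_integrable T hT H hH (fun s => ((X s, u1 s, u2 s), l s)) ?_
    (((X '' Icc 0 T) ×ˢ (Icc (0:ℝ) 1 ×ˢ Icc (0:ℝ) 1)) ×ˢ (l '' Icc 0 T)) ?_ ?_
  · exact (hX.measurable.prodMk (hm1.prodMk hm2)).prodMk hl.measurable
  · exact ((isCompact_Icc.image hX).prod (isCompact_Icc.prod isCompact_Icc)).prod
      (isCompact_Icc.image hl)
  · intro s hs
    exact ⟨⟨mem_image_of_mem _ hs, hu s hs⟩, mem_image_of_mem _ hs⟩

theorem tbaux_proj (u ψ : ℝ) (h0 : 0 ≤ u) (h1 : u ≤ 1) :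
    (min (max 0 ψ) 1 - u) * (u - ψ) ≤ -(min (max 0 ψ) 1 - u) ^ 2 := by
  rcases le_total 0 ψ with h | h
  · rw [max_eq_right h]
    rcases le_total ψ 1 with h' | h'
    · rw [min_eq_left h']; nlinarith
    · rw [min_eq_right h']; nlinarith
  · rw [max_eq_left h, min_eq_left zero_le_one]; nlinarith

open MeasureTheory Set in
theorem tbaux_intervalIntegral_apply (f : ℝ → Fin 5 → ℝ) (a b : ℝ)
    (hf : IntervalIntegrable f volume a b) (i : Fin 5) :
    (∫ s in a..b, f s) i = ∫ s in a..b, f s i :=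
  ((ContinuousLinearMap.proj (R := ℝ) (φ := fun _ : Fin 5 => ℝ) i).intervalIntegral_comp_comm
    hf).symm

theorem tbaux_int_comp (f : ℝ → Fin 5 → ℝ) (a b : ℝ)
    (hf : IntervalIntegrable f MeasureTheory.volume a b) (i : Fin 5) :
    IntervalIntegrable (fun s => f s i) MeasureTheory.volume a b :=
  ⟨(ContinuousLinearMap.proj (R := ℝ) (φ := fun _ : Fin 5 => ℝ) i).integrable_comp hf.1,
   (ContinuousLinearMap.proj (R := ℝ) (φ := fun _ : Fin 5 => ℝ) i).integrable_comp hf.2⟩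

open MeasureTheory Set in
theorem tbaux_main
    (μ β δ ω ωR σ σR τ0 τ1 τ2 N ε1 ε2 φ W1 W2 : ℝ)
    (hW1 : 0 < W1) (hW2 : 0 < W2)
    (T : ℝ) (hT : 0 < T) (x₀ : Fin 5 → ℝ)
    (u1 u2 : ℝ → ℝ) (X : ℝ → Fin 5 → ℝ) (hX : Continuous X)
    (hadm : IsAdmissible T u1 u2)
    (htraj : IsTrajectory μ β δ ω ωR σ σR τ0 τ1 τ2 N ε1 ε2 φ T x₀ u1 u2 X)
    (hopt : ∀ (v1 v2 : ℝ → ℝ) (x : ℝ → Fin 5 → ℝ),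
      IsAdmissible T v1 v2 →
      IsTrajectory μ β δ ω ωR σ σR τ0 τ1 τ2 N ε1 ε2 φ T x₀ v1 v2 x →
      tbCost W1 W2 T u1 u2 X ≤ tbCost W1 W2 T v1 v2 x)
    (l : ℝ → Fin 5 → ℝ) (hl : Continuous l)
    (hadj : ∀ t ∈ Icc (0 : ℝ) T,
        l t = -∫ s in t..T, tbAdjRHS μ β δ ω ωR σ σR τ0 τ1 τ2 N ε1 ε2 φ
          (X s) (u1 s) (u2 s) (l s)) :
    ∀ᵐ t ∂(volume.restrict (Icc (0 : ℝ) T)),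
        u1 t = min (max 0 (ε1 * X t 2 * (l t 2 - l t 4) / W1)) 1 ∧
        u2 t = min (max 0 (ε2 * X t 3 * (l t 3 - l t 4) / W2)) 1 := by
  set p1 : ℝ → ℝ := fun t => min (max 0 (ε1 * X t 2 * (l t 2 - l t 4) / W1)) 1 with hp1
  set p2 : ℝ → ℝ := fun t => min (max 0 (ε2 * X t 3 * (l t 3 - l t 4) / W2)) 1 with hp2
  have hp1c : Continuous p1 := by fun_prop
  have hp2c : Continuous p2 := by fun_prop
  have hpadm : IsAdmissible T p1 p2 := by
    refine ⟨hp1c.measurable, hp2c.measurable, fun t _ => ⟨⟨?_, ?_⟩, ?_, ?_⟩⟩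
    · exact le_min (le_max_left _ _) zero_le_one
    · exact min_le_right _ _
    · exact le_min (le_max_left _ _) zero_le_one
    · exact min_le_right _ _
  obtain ⟨C, h₀, hh₀, hpert⟩ := tbaux_perturb μ β δ ω ωR σ σR τ0 τ1 τ2 N ε1 ε2 φ T hT
    u1 u2 p1 p2 hadm hpadm X hX x₀ htraj
  obtain ⟨CQ, hCQ⟩ := (((isCompact_Icc (a := 0) (b := T)).image hl).prod
    ((isCompact_closedBall (0 : Fin 5 → ℝ) C).prod
      ((isCompact_Icc (a := (-1:ℝ)) (b := 1)).prod
        (isCompact_Icc (a := (-1:ℝ)) (b := 1))))).exists_bound_of_continuousOn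
    (tbauxQ_cont β σ σR N ε1 ε2).continuousOn
  set B : ℝ → ℝ := fun t => W1 * (p1 t - u1 t) ^ 2 + W2 * (p2 t - u2 t) ^ 2 with hBdef
  set b := ∫ t in (0:ℝ)..T, B t with hb
  have hBint : IntervalIntegrable B volume 0 T := by
    refine tbaux_int_adm T hT.le u1 u2 hadm X l hX hl
      (fun q => W1 * (min (max 0 (ε1 * q.1.1 2 * (q.2 2 - q.2 4) / W1)) 1 - q.1.2.1) ^ 2
        + W2 * (min (max 0 (ε2 * q.1.1 3 * (q.2 3 - q.2 4) / W2)) 1 - q.1.2.2) ^ 2) ?_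
    fun_prop
  have hFc : Continuous (fun p : (Fin 5 → ℝ) × ℝ × ℝ =>
    tbRHS μ β δ ω ωR σ σR τ0 τ1 τ2 N ε1 ε2 φ p.1 p.2.1 p.2.2) :=
    (tbaux_contDiff μ β δ ω ωR σ σR τ0 τ1 τ2 N ε1 ε2 φ).continuous
  have hGc := tbaux_adj_cont μ β δ ω ωR σ σR τ0 τ1 τ2 N ε1 ε2 φ
  have hFint : ∀ (v1 v2 : ℝ → ℝ), IsAdmissible T v1 v2 → ∀ x : ℝ → Fin 5 → ℝ, Continuous x →
      IntervalIntegrable (fun s => tbRHS μ β δ ω ωR σ σR τ0 τ1 τ2 N ε1 ε2 φ (x s) (v1 s) (v2 s))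
        volume 0 T := fun v1 v2 hv x hx =>
    tbaux_int_adm T hT.le v1 v2 hv x l hx hl _ (hFc.comp continuous_fst)
  have hCint : ∀ (v1 v2 : ℝ → ℝ), IsAdmissible T v1 v2 → ∀ x : ℝ → Fin 5 → ℝ, Continuous x →
      IntervalIntegrable (fun t => x t 2 + x t 3 + W1 / 2 * v1 t ^ 2 + W2 / 2 * v2 t ^ 2)
        volume 0 T := fun v1 v2 hv x hx =>
    tbaux_int_adm T hT.le v1 v2 hv x l hx hl
      (fun q => q.1.1 2 + q.1.1 3 + W1 / 2 * q.1.2.1 ^ 2 + W2 / 2 * q.1.2.2 ^ 2) (by fun_prop)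
  have hGint : IntervalIntegrable (fun s => tbAdjRHS μ β δ ω ωR σ σR τ0 τ1 τ2 N ε1 ε2 φ
      (X s) (u1 s) (u2 s) (l s)) volume 0 T :=
    tbaux_int_adm T hT.le u1 u2 hadm X l hX hl _ hGc
  set D : ℝ := W1 / 2 + W2 / 2 + CQ with hD
  have key : ∀ h, 0 < h → h ≤ h₀ → b ≤ D * T * h := by
    intro h h0 hle
    obtain ⟨hwadm, x, hxc, hxtr, hxb⟩ := hpert h h0 hle
    have hcost := hopt _ _ x hwadm hxtr
    set w1 := fun s => u1 s + h * (p1 s - u1 s) with hw1d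
    set w2 := fun s => u2 s + h * (p2 s - u2 s) with hw2d
    set k : ℝ → Fin 5 → ℝ := fun s => tbRHS μ β δ ω ωR σ σR τ0 τ1 τ2 N ε1 ε2 φ (x s) (w1 s) (w2 s)
      - tbRHS μ β δ ω ωR σ σR τ0 τ1 τ2 N ε1 ε2 φ (X s) (u1 s) (u2 s) with hk
    set g : ℝ → Fin 5 → ℝ := fun s => tbAdjRHS μ β δ ω ωR σ σR τ0 τ1 τ2 N ε1 ε2 φ
      (X s) (u1 s) (u2 s) (l s) with hg
    have hkint : IntervalIntegrable k volume 0 T :=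
      (hFint w1 w2 hwadm x hxc).sub (hFint u1 u2 hadm X hX)
    have hsub : ∀ t ∈ Icc 0 T, uIcc 0 t ⊆ uIcc 0 T := by
      intro t ht
      rw [uIcc_of_le ht.1, uIcc_of_le hT.le]
      exact Icc_subset_Icc le_rfl ht.2
    have hsub' : ∀ t ∈ Icc 0 T, uIcc t T ⊆ uIcc 0 T := by
      intro t ht
      rw [uIcc_of_le ht.2, uIcc_of_le hT.le]
      exact Icc_subset_Icc ht.1 le_rfl
    have hdiff : ∀ t ∈ Icc 0 T, ∀ i, x t i - X t i = ∫ s in (0:ℝ)..t, k s i := by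
      intro t ht i
      rw [← tbaux_intervalIntegral_apply k 0 t (hkint.mono_set (hsub t ht)), hk,
        intervalIntegral.integral_sub ((hFint w1 w2 hwadm x hxc).mono_set (hsub t ht))
          ((hFint u1 u2 hadm X hX).mono_set (hsub t ht)), hxtr.2 t ht, htraj.2 t ht]
      simp
    have hadj' : ∀ t ∈ Icc 0 T, ∀ i, l t i = -∫ s in t..T, g s i := by
      intro t ht i
      rw [← tbaux_intervalIntegral_apply g t T (hGint.mono_set (hsub' t ht)), hadj t ht]
      rfl
    have hlk : ∀ i, IntervalIntegrable (fun t => l t i * k t i + g t i * (x t i - X t i))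
        volume 0 T := by
      intro i
      refine ((tbaux_int_comp k 0 T hkint i).continuousOn_mul ?_).add
        ((tbaux_int_comp g 0 T hGint i).mul_continuousOn ?_)
      · exact (by fun_prop : Continuous fun t => l t i).continuousOn
      · exact (by fun_prop : Continuous fun t => x t i - X t i).continuousOn
    have hibp : ∀ i, ∫ t in (0:ℝ)..T, (l t i * k t i + g t i * (x t i - X t i)) = 0 := by
      intro i
      refine Eq.trans ?_ (tbaux_ibp T (fun s => g s i) (fun s => k s i)
        (tbaux_int_comp g 0 T hGint i) (tbaux_int_comp k 0 T hkint i))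
      apply intervalIntegral.integral_congr
      intro t ht
      rw [uIcc_of_le hT.le] at ht
      simp only
      rw [hdiff t ht i, hadj' t ht i]
    have hsum : ∫ t in (0:ℝ)..T, ∑ i, (l t i * k t i + g t i * (x t i - X t i)) = 0 := by
      rw [intervalIntegral.integral_finsetSum (fun i _ => hlk i)]
      simp [hibp]
    have hsumint : IntervalIntegrable
        (fun t => ∑ i, (l t i * k t i + g t i * (x t i - X t i))) volume 0 T := by
      simp only [Fin.sum_univ_five]
      exact ((((hlk 0).add (hlk 1)).add (hlk 2)).add (hlk 3)).add (hlk 4)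
    have hc1 := hCint w1 w2 hwadm x hxc
    have hc2 := hCint u1 u2 hadm X hX
    have htot : 0 ≤ ∫ t in (0:ℝ)..T, ((x t 2 + x t 3 + W1 / 2 * w1 t ^ 2 + W2 / 2 * w2 t ^ 2)
        - (X t 2 + X t 3 + W1 / 2 * u1 t ^ 2 + W2 / 2 * u2 t ^ 2)
        + ∑ i, (l t i * k t i + g t i * (x t i - X t i))) := by
      rw [intervalIntegral.integral_add (hc1.sub hc2) hsumint, hsum,
        intervalIntegral.integral_sub hc1 hc2]
      unfold tbCost at hcost
      linarith
    have hmono := intervalIntegral.integral_mono_on hT.le ((hc1.sub hc2).add hsumint)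
      ((hBint.const_mul (-h)).add (intervalIntegrable_const (c := D * h ^ 2))) (by
      intro t ht
      have hid := tbaux_identity μ β δ ω ωR σ σR τ0 τ1 τ2 N ε1 ε2 φ (X t) (x t) (l t)
        (h⁻¹ • (x t - X t)) (u1 t) (u2 t) (p1 t - u1 t) (p2 t - u2 t) h (by
          rw [smul_smul, mul_inv_cancel₀ h0.ne', one_smul]; abel)
      obtain ⟨⟨a1, a2⟩, a3, a4⟩ := hadm.2.2 t ht
      obtain ⟨⟨b1, b2⟩, b3, b4⟩ := hpadm.2.2 t ht
      have hq := hCQ (l t, h⁻¹ • (x t - X t), p1 t - u1 t, p2 t - u2 t) (by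
        refine ⟨mem_image_of_mem _ ht, ?_, ⟨?_, ?_⟩, ?_, ?_⟩
        · simp only [mem_closedBall_zero_iff]
          rw [norm_smul, norm_inv, Real.norm_eq_abs, abs_of_pos h0,
            inv_mul_le_iff₀ h0, mul_comm]
          exact hxb t ht
        all_goals simp only; linarith)
      replace hq := (le_abs_self _).trans hq
      have hj1 := tbaux_proj (u1 t) (ε1 * X t 2 * (l t 2 - l t 4) / W1) a1 a2
      have hj2 := tbaux_proj (u2 t) (ε2 * X t 3 * (l t 3 - l t 4) / W2) a3 a4
      change (p1 t - u1 t) * _ ≤ -(p1 t - u1 t) ^ 2 at hj1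
      change (p2 t - u2 t) * _ ≤ -(p2 t - u2 t) ^ 2 at hj2
      have hj1' := mul_le_mul_of_nonneg_left hj1 (mul_pos h0 hW1).le
      have hj2' := mul_le_mul_of_nonneg_left hj2 (mul_pos h0 hW2).le
      have e1 : h * W1 * ((p1 t - u1 t) * (u1 t - ε1 * X t 2 * (l t 2 - l t 4) / W1)) =
        h * ((p1 t - u1 t) * (W1 * u1 t - ε1 * X t 2 * (l t 2 - l t 4))) := by field_simp
      have e2 : h * W2 * ((p2 t - u2 t) * (u2 t - ε2 * X t 3 * (l t 3 - l t 4) / W2)) =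
        h * ((p2 t - u2 t) * (W2 * u2 t - ε2 * X t 3 * (l t 3 - l t 4))) := by field_simp
      rw [e1] at hj1'
      rw [e2] at hj2'
      have hs1 : (p1 t - u1 t) ^ 2 ≤ 1 := by nlinarith
      have hs2 : (p2 t - u2 t) ^ 2 ≤ 1 := by nlinarith
      have hs1' := mul_le_mul_of_nonneg_left hs1 (mul_pos hW1 (pow_pos h0 2)).le
      have hs2' := mul_le_mul_of_nonneg_left hs2 (mul_pos hW2 (pow_pos h0 2)).le
      have hq' := mul_le_mul_of_nonneg_left hq (pow_pos h0 2).le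
      change _ - _ + ∑ i, (l t i * (tbRHS μ β δ ω ωR σ σR τ0 τ1 τ2 N ε1 ε2 φ (x t)
          (u1 t + h * (p1 t - u1 t)) (u2 t + h * (p2 t - u2 t)) i
        - tbRHS μ β δ ω ωR σ σR τ0 τ1 τ2 N ε1 ε2 φ (X t) (u1 t) (u2 t) i)
        + tbAdjRHS μ β δ ω ωR σ σR τ0 τ1 τ2 N ε1 ε2 φ (X t) (u1 t) (u2 t) (l t) i
          * (x t i - X t i)) ≤ -h * (W1 * (p1 t - u1 t) ^ 2 + W2 * (p2 t - u2 t) ^ 2)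
            + (W1 / 2 + W2 / 2 + CQ) * h ^ 2
      rw [hid]
      simp only [hw1d, hw2d]
      linarith)
    have h3 := htot.trans hmono
    rw [intervalIntegral.integral_add (hBint.const_mul (-h)) intervalIntegrable_const,
      intervalIntegral.integral_const_mul, intervalIntegral.integral_const] at h3
    simp only [sub_zero, smul_eq_mul] at h3
    have h4 : h * b ≤ h * (D * T * h) := by
      rw [hb]; linarith
    exact le_of_mul_le_mul_left h4 h0
  have hb0 : b ≤ 0 := by
    have ht : Filter.Tendsto (fun h : ℝ => D * T * h) (nhdsWithin 0 (Ioi 0)) (nhds 0) := by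
      have : Continuous fun h : ℝ => D * T * h := by fun_prop
      have h1 := this.tendsto 0
      rw [mul_zero] at h1
      exact h1.mono_left nhdsWithin_le_nhds
    refine ge_of_tendsto ht ?_
    filter_upwards [Ioc_mem_nhdsGT hh₀] with h hh using key h hh.1 hh.2
  have hBnn : ∀ t, 0 ≤ B t := fun t => by positivity
  have hBI : Integrable B (volume.restrict (Icc 0 T)) := by
    rw [← IntegrableOn, integrableOn_Icc_iff_integrableOn_Ioc,
      ← intervalIntegrable_iff_integrableOn_Ioc_of_le hT.le]
    exact hBint
  have hBz : ∫ t in Icc 0 T, B t = 0 := by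
    refine le_antisymm ?_ (integral_nonneg hBnn)
    rw [integral_Icc_eq_integral_Ioc, ← intervalIntegral.integral_of_le hT.le]
    exact hb0
  rw [integral_eq_zero_iff_of_nonneg hBnn hBI] at hBz
  filter_upwards [hBz] with t ht
  have ht' : W1 * (p1 t - u1 t) ^ 2 + W2 * (p2 t - u2 t) ^ 2 = 0 := ht
  have hs1 : 0 ≤ W1 * (p1 t - u1 t) ^ 2 := by positivity
  have hs2 : 0 ≤ W2 * (p2 t - u2 t) ^ 2 := by positivity
  have z1 : W1 * (p1 t - u1 t) ^ 2 = 0 := by linarith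
  have z2 : W2 * (p2 t - u2 t) ^ 2 = 0 := by linarith
  constructor
  · have := (mul_eq_zero.1 z1).resolve_left hW1.ne'
    have := pow_eq_zero_iff (two_ne_zero) |>.1 this
    linarith
  · have := (mul_eq_zero.1 z2).resolve_left hW2.ne'
    have := pow_eq_zero_iff (two_ne_zero) |>.1 this
    linarith

open MeasureTheory in
/-- Pontryagin necessary conditions for the TB optimal
control problem: an optimal control pair admits absolutely continuous adjoint
functions — expressed through the integral form
`λ(t) = −∫ₜᵀ (adjoint right-hand side)(s) ds`, which encodes absolute
continuity, the adjoint ODE almost everywhere, and the transversality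
conditions `λᵢ(T) = 0` — such that almost everywhere the optimal controls are
given by the stated projection formulas. -/
theorem tb_pontryagin_necessary_conditions
    (μ β δ ω ωR σ σR τ0 τ1 τ2 N ε1 ε2 φ W1 W2 : ℝ)
    (hμ : 0 < μ) (hβ : 0 < β) (hδ : 0 < δ) (hω : 0 < ω) (hωR : 0 < ωR)
    (hσ : 0 < σ) (hσR : 0 < σR) (hτ0 : 0 < τ0) (hτ1 : 0 < τ1) (hτ2 : 0 < τ2)
    (hN : 0 < N) (hε1 : 0 < ε1) (hε2 : 0 < ε2) (hφ : φ ∈ Set.Ioo (0 : ℝ) 1)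
    (hW1 : 0 < W1) (hW2 : 0 < W2)
    (T : ℝ) (hT : 0 < T)
    (x₀ : Fin 5 → ℝ) (hx₀ : ∀ i, 0 ≤ x₀ i)
    (hx₀sum : x₀ 0 + x₀ 1 + x₀ 2 + x₀ 3 + x₀ 4 = N)
    (u1s u2s : ℝ → ℝ) (xs : ℝ → Fin 5 → ℝ)
    (hadm : IsAdmissible T u1s u2s)
    (htraj : IsTrajectory μ β δ ω ωR σ σR τ0 τ1 τ2 N ε1 ε2 φ T x₀ u1s u2s xs)
    (hopt : ∀ (u1 u2 : ℝ → ℝ) (x : ℝ → Fin 5 → ℝ),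
      IsAdmissible T u1 u2 →
      IsTrajectory μ β δ ω ωR σ σR τ0 τ1 τ2 N ε1 ε2 φ T x₀ u1 u2 x →
      tbCost W1 W2 T u1s u2s xs ≤ tbCost W1 W2 T u1 u2 x) :
    ∃ l : ℝ → Fin 5 → ℝ,
      (∀ t ∈ Set.Icc (0 : ℝ) T,
        l t = -∫ s in t..T, tbAdjRHS μ β δ ω ωR σ σR τ0 τ1 τ2 N ε1 ε2 φ
          (xs s) (u1s s) (u2s s) (l s)) ∧
      l T = 0 ∧
      (∀ᵐ t ∂(volume.restrict (Set.Icc (0 : ℝ) T)),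
        u1s t = min (max 0 (ε1 * xs t 2 * (l t 2 - l t 4) / W1)) 1 ∧
        u2s t = min (max 0 (ε2 * xs t 3 * (l t 3 - l t 4) / W2)) 1) := by
  have hc := htraj.1
  set X : ℝ → Fin 5 → ℝ := Set.IccExtend hT.le (fun t : Set.Icc (0:ℝ) T => xs t) with hXd
  have hX : Continuous X := (continuousOn_iff_continuous_domRestrict.1 hc).Icc_extend'
  have hXe : ∀ t ∈ Set.Icc (0:ℝ) T, X t = xs t := fun t ht => by
    rw [hXd, Set.IccExtend_of_mem _ _ ht]
  have hXtr : IsTrajectory μ β δ ω ωR σ σR τ0 τ1 τ2 N ε1 ε2 φ T x₀ u1s u2s X := by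
    refine ⟨hX.continuousOn, fun t ht => ?_⟩
    rw [hXe t ht, htraj.2 t ht]
    congr 1
    apply intervalIntegral.integral_congr
    intro s hs
    rw [Set.uIcc_of_le ht.1] at hs
    simp only
    rw [hXe s ⟨hs.1, hs.2.trans ht.2⟩]
  have hcost : tbCost W1 W2 T u1s u2s X = tbCost W1 W2 T u1s u2s xs := by
    unfold tbCost
    apply intervalIntegral.integral_congr
    intro s hs
    rw [Set.uIcc_of_le hT.le] at hs
    simp only
    rw [hXe s hs]
  obtain ⟨l, hl, hadj⟩ := tbaux_adjoint μ β δ ω ωR σ σR τ0 τ1 τ2 N ε1 ε2 φ T hT u1s u2s hadm X hX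
  have hmain := tbaux_main μ β δ ω ωR σ σR τ0 τ1 τ2 N ε1 ε2 φ W1 W2 hW1 hW2 T hT x₀ u1s u2s X hX
    hadm hXtr (fun v1 v2 x hv hx => by rw [hcost]; exact hopt v1 v2 x hv hx) l hl hadj
  refine ⟨l, ?_, ?_, ?_⟩
  · intro t ht
    rw [hadj t ht]
    congr 1
    apply intervalIntegral.integral_congr
    intro s hs
    rw [Set.uIcc_of_le ht.2] at hs
    simp only
    rw [hXe s ⟨ht.1.trans hs.1, hs.2⟩]
  · rw [hadj T ⟨hT.le, le_rfl⟩]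
    simp
  · filter_upwards [hmain, ae_restrict_mem measurableSet_Icc] with t h1 h2
    rw [← hXe t h2]
    exact h1
end

section
/- Fix an initial condition x₀ = (S₀, L1₀, I₀, L2₀, R₀) ∈ ℝ⁵ with all entries nonnegative and summing to N. There exists T₀ > 0 such that for every final time T with 0 < T ≤ T₀, the optimal control pair is unique: if (u1, u2) and (v1, v2) are two admissible control pairs on [0,T], each minimizing the cost functional J over all admissible pairs with trajectories starting from x₀, then u1(t) = v1(t) and u2(t) = v2(t) for almost every t ∈ [0,T], and the associated state trajectories coincide on [0,T]. -/
section TBAux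

open MeasureTheory

structure TBGood (F : (Fin 5 → ℝ) → ℝ → ℝ → (Fin 5 → ℝ)) (M K : ℝ) : Prop where
  cont : Continuous fun p : (Fin 5 → ℝ) × ℝ × ℝ => F p.1 p.2.1 p.2.2
  Kpos : 0 < K
  bd : ∀ x a b, ‖x‖ ≤ M → a ∈ Set.Icc (0:ℝ) 1 → b ∈ Set.Icc (0:ℝ) 1 → ‖F x a b‖ ≤ K
  lip : ∀ x y a b c d, ‖x‖ ≤ M → ‖y‖ ≤ M → a ∈ Set.Icc (0:ℝ) 1 → b ∈ Set.Icc (0:ℝ) 1 →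
    c ∈ Set.Icc (0:ℝ) 1 → d ∈ Set.Icc (0:ℝ) 1 →
    ‖F x a b - F y c d‖ ≤ K * (‖x - y‖ + (|a - c| + |b - d|))
  mid : ∀ x y a b c d, ‖F ((1/2:ℝ) • (x + y)) ((a + c)/2) ((b + d)/2)
      - (1/2:ℝ) • (F x a b + F y c d)‖ ≤ K * ‖x - y‖ * (‖x - y‖ + (|a - c| + |b - d|))

def TBTraj (F : (Fin 5 → ℝ) → ℝ → ℝ → (Fin 5 → ℝ)) (T : ℝ) (x₀ : Fin 5 → ℝ)
    (u1 u2 : ℝ → ℝ) (x : ℝ → Fin 5 → ℝ) : Prop :=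
  ContinuousOn x (Set.Icc (0 : ℝ) T) ∧
    ∀ t ∈ Set.Icc (0 : ℝ) T, x t = x₀ + ∫ s in (0 : ℝ)..t, F (x s) (u1 s) (u2 s)

lemma tb_integrable {F : (Fin 5 → ℝ) → ℝ → ℝ → (Fin 5 → ℝ)} {M K T : ℝ} (hF : TBGood F M K)
    {u1 u2 : ℝ → ℝ} {x : ℝ → Fin 5 → ℝ} (hu : IsAdmissible T u1 u2)
    (hx : ContinuousOn x (Set.Icc 0 T)) (hM : ∀ t ∈ Set.Icc 0 T, ‖x t‖ ≤ M) :
    ∀ t ∈ Set.Icc 0 T, IntervalIntegrable (fun s => F (x s) (u1 s) (u2 s)) volume 0 t := by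
  intro t ht
  obtain ⟨h1, h2, h3⟩ := hu
  have key : IntegrableOn (fun s => F (x s) (u1 s) (u2 s)) (Set.Icc 0 T) volume := by
    have : IsFiniteMeasure (volume.restrict (Set.Icc (0:ℝ) T)) := ⟨by simp⟩
    refine Integrable.of_bound (C := K) ?_ ?_
    · have hxm : AEStronglyMeasurable x (volume.restrict (Set.Icc (0:ℝ) T)) :=
        hx.aestronglyMeasurable measurableSet_Icc
      exact hF.cont.comp_aestronglyMeasurable
        (hxm.prodMk ((h1.aestronglyMeasurable).prodMk (h2.aestronglyMeasurable)))
    · refine (ae_restrict_iff' measurableSet_Icc).2 (Filter.Eventually.of_forall fun s hs => ?_)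
      exact hF.bd _ _ _ (hM s hs) (h3 s hs).1 (h3 s hs).2
  rw [intervalIntegrable_iff_integrableOn_Icc_of_le ht.1]
  exact key.mono_set (Set.Icc_subset_Icc_right ht.2)

lemma tb_apriori {F : (Fin 5 → ℝ) → ℝ → ℝ → (Fin 5 → ℝ)} {K T : ℝ} {x₀ : Fin 5 → ℝ}
    (hF : TBGood F (‖x₀‖ + 1) K) (hKT : K * T ≤ 1/2)
    {u1 u2 : ℝ → ℝ} {x : ℝ → Fin 5 → ℝ} (hu : IsAdmissible T u1 u2)
    (hx : TBTraj F T x₀ u1 u2 x) : ∀ t ∈ Set.Icc 0 T, ‖x t‖ ≤ ‖x₀‖ + 1 := by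
  obtain ⟨hc, hx⟩ := hx
  intro t ht
  by_contra hcon
  have hdist : ∀ s, ‖x s - x₀‖ ≤ 1 → ‖x s‖ ≤ ‖x₀‖ + 1 := by
    intro s hs
    have := norm_add_le x₀ (x s - x₀)
    rw [add_sub_cancel] at this
    linarith
  have hgt : 1 < ‖x t - x₀‖ := by
    by_contra h
    exact hcon (hdist t (not_lt.1 h))
  have hcf : ContinuousOn (fun s => ‖x s - x₀‖) (Set.Icc 0 T) :=
    (hc.sub continuousOn_const).norm
  set A : Set ℝ := Set.Icc 0 T ∩ (fun s => ‖x s - x₀‖) ⁻¹' (Set.Ici 1) with hA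
  have hAc : IsClosed A := hcf.preimage_isClosed_of_isClosed isClosed_Icc isClosed_Ici
  have hAne : A.Nonempty := ⟨t, ht, hgt.le⟩
  have hAb : BddBelow A := ⟨0, fun s hs => hs.1.1⟩
  have hmem := hAc.csInf_mem hAne hAb
  set r := sInf A with hr
  have hrI := hmem.1
  have hr1 : 1 ≤ ‖x r - x₀‖ := hmem.2
  have hb : ∀ s ∈ Set.uIoc 0 r, s ∈ Set.Icc 0 T ∧ (s < r → ‖x s‖ ≤ ‖x₀‖ + 1) := by
    intro s hs
    rw [Set.uIoc_of_le hrI.1] at hs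
    have hsI : s ∈ Set.Icc 0 T := ⟨hs.1.le, hs.2.trans hrI.2⟩
    refine ⟨hsI, fun hlt => hdist s ?_⟩
    by_contra h
    have : s ∈ A := ⟨hsI, (not_le.1 h).le⟩
    exact absurd (csInf_le hAb this) (not_le.2 hlt)
  have hint : ‖∫ s in (0:ℝ)..r, F (x s) (u1 s) (u2 s)‖ ≤ K * |r - 0| := by
    refine intervalIntegral.norm_integral_le_of_norm_le_const_ae ?_
    have : ∀ᵐ s : ℝ, s ≠ r := by simp [ae_iff]
    filter_upwards [this] with s hs hsm
    have h := hb s hsm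
    have hle : s ≤ r := by rw [Set.uIoc_of_le hrI.1] at hsm; exact hsm.2
    exact hF.bd _ _ _ (h.2 (lt_of_le_of_ne hle hs)) (hu.2.2 s h.1).1 (hu.2.2 s h.1).2
  have e : x r - x₀ = ∫ s in (0:ℝ)..r, F (x s) (u1 s) (u2 s) := by
    rw [hx r hrI]; simp
  rw [e, ] at hr1
  rw [sub_zero, abs_of_nonneg hrI.1] at hint
  have := mul_le_mul_of_nonneg_left hrI.2 hF.Kpos.le
  linarith

def tbClamp (M : ℝ) (x : Fin 5 → ℝ) : Fin 5 → ℝ := fun i => max (min (x i) M) (-M)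

lemma tbClamp_norm {M : ℝ} (hM : 0 ≤ M) (x : Fin 5 → ℝ) : ‖tbClamp M x‖ ≤ M := by
  refine (pi_norm_le_iff_of_nonneg hM).2 fun i => ?_
  rw [Real.norm_eq_abs, abs_le]
  exact ⟨le_max_right _ _, max_le (min_le_right _ _) (by linarith)⟩

lemma tbClamp_lip (M : ℝ) (x y : Fin 5 → ℝ) : ‖tbClamp M x - tbClamp M y‖ ≤ ‖x - y‖ := by
  refine (pi_norm_le_iff_of_nonneg (norm_nonneg _)).2 fun i => ?_
  refine le_trans ?_ (norm_le_pi_norm (x - y) i)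
  simp only [tbClamp, Pi.sub_apply, Real.norm_eq_abs]
  exact (abs_max_sub_max_le_abs _ _ _).trans (by
    simpa using abs_min_sub_min_le_max (x i) M (y i) M)

lemma tbClamp_eq {M : ℝ} (x : Fin 5 → ℝ) (h : ‖x‖ ≤ M) : tbClamp M x = x := by
  funext i
  have := (norm_le_pi_norm x i).trans h
  rw [Real.norm_eq_abs, abs_le] at this
  simp [tbClamp, this.1, this.2]

lemma tbClamp_cont (M : ℝ) : Continuous (tbClamp M) := by
  unfold tbClamp; fun_prop

lemma tb_exists_s9 {F : (Fin 5 → ℝ) → ℝ → ℝ → (Fin 5 → ℝ)} {K T : ℝ} {x₀ : Fin 5 → ℝ}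
    (hF : TBGood F (‖x₀‖ + 1) K) (hT : 0 ≤ T) (hKT : K * T ≤ 1/2)
    {u1 u2 : ℝ → ℝ} (hu : IsAdmissible T u1 u2) :
    ∃ z, TBTraj F T x₀ u1 u2 z := by
  set M := ‖x₀‖ + 1 with hMdef
  have hM0 : 0 ≤ M := by positivity
  let g : C(Set.Icc (0:ℝ) T, Fin 5 → ℝ) → ℝ → (Fin 5 → ℝ) :=
    fun z s => tbClamp M (Set.IccExtend hT z s)
  have hgc : ∀ z, Continuous (g z) := fun z => (tbClamp_cont M).comp (z.continuous.Icc_extend')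
  have hgM : ∀ z s, ‖g z s‖ ≤ M := fun z s => tbClamp_norm hM0 _
  have hgi := fun z => tb_integrable hF hu (hgc z).continuousOn (fun t _ => hgM z t)
  have hTm : T ∈ Set.Icc 0 T := ⟨hT, le_rfl⟩
  have hcont : ∀ z, ContinuousOn (fun t => x₀ + ∫ s in (0:ℝ)..t, F (g z s) (u1 s) (u2 s))
      (Set.Icc 0 T) := by
    intro z
    refine continuousOn_const.add ?_
    have := intervalIntegral.continuousOn_primitive_interval (μ := volume) (a := 0) (b := T)
      (f := fun s => F (g z s) (u1 s) (u2 s)) (by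
        rw [Set.uIcc_of_le hT]
        exact (intervalIntegrable_iff_integrableOn_Icc_of_le hT).1 (hgi z T hTm))
    rwa [Set.uIcc_of_le hT] at this
  let Φ : C(Set.Icc (0:ℝ) T, Fin 5 → ℝ) → C(Set.Icc (0:ℝ) T, Fin 5 → ℝ) := fun z =>
    ⟨fun t => x₀ + ∫ s in (0:ℝ)..(t:ℝ), F (g z s) (u1 s) (u2 s),
      continuousOn_iff_continuous_domRestrict.1 (hcont z)⟩
  have hΦ : ContractingWith (1/2 : NNReal) Φ := by
    refine ⟨by rw [← NNReal.coe_lt_coe]; norm_num, LipschitzWith.of_dist_le_mul fun z w => ?_⟩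
    refine (ContinuousMap.dist_le (by positivity)).2 fun t => ?_
    rw [dist_eq_norm]
    change ‖(x₀ + ∫ s in (0:ℝ)..(t:ℝ), F (g z s) (u1 s) (u2 s)) -
      (x₀ + ∫ s in (0:ℝ)..(t:ℝ), F (g w s) (u1 s) (u2 s))‖ ≤ _
    rw [add_sub_add_left_eq_sub, ← intervalIntegral.integral_sub (hgi z t t.2) (hgi w t t.2)]
    have h1 : ‖∫ s in (0:ℝ)..(t:ℝ), (F (g z s) (u1 s) (u2 s) - F (g w s) (u1 s) (u2 s))‖
        ≤ (K * dist z w) * |(t:ℝ) - 0| := by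
      refine intervalIntegral.norm_integral_le_of_norm_le_const fun s hs => ?_
      rw [Set.uIoc_of_le t.2.1] at hs
      have hsI : s ∈ Set.Icc 0 T := ⟨hs.1.le, hs.2.trans t.2.2⟩
      have ha := hu.2.2 s hsI
      refine (hF.lip _ _ _ _ _ _ (hgM z s) (hgM w s) ha.1 ha.2 ha.1 ha.2).trans ?_
      refine mul_le_mul_of_nonneg_left ?_ hF.Kpos.le
      simp only [sub_self, abs_zero, add_zero]
      refine (tbClamp_lip M _ _).trans ?_
      rw [← dist_eq_norm]
      exact ContinuousMap.dist_apply_le_dist _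
    refine h1.trans ?_
    rw [sub_zero, abs_of_nonneg t.2.1]
    have h2 := mul_le_mul_of_nonneg_left t.2.2 hF.Kpos.le
    have h3 : K * (t:ℝ) ≤ 1/2 := h2.trans hKT
    have h4 := mul_le_mul_of_nonneg_right h3 (dist_nonneg (x := z) (y := w))
    push_cast
    linarith
  obtain ⟨z, hz⟩ : ∃ z, Φ z = z := ⟨_, hΦ.fixedPoint_isFixedPt⟩
  have hzt : ∀ t ∈ Set.Icc 0 T, Set.IccExtend hT z t =
      x₀ + ∫ s in (0:ℝ)..t, F (g z s) (u1 s) (u2 s) := by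
    intro t ht
    rw [Set.IccExtend_of_mem hT _ ht]
    conv_lhs => rw [← hz]
    rfl
  have hzM : ∀ t ∈ Set.Icc 0 T, ‖Set.IccExtend hT z t‖ ≤ M := by
    intro t ht
    rw [hzt t ht]
    have h1 : ‖∫ s in (0:ℝ)..t, F (g z s) (u1 s) (u2 s)‖ ≤ K * |t - 0| := by
      refine intervalIntegral.norm_integral_le_of_norm_le_const fun s hs => ?_
      rw [Set.uIoc_of_le ht.1] at hs
      have ha := hu.2.2 s ⟨hs.1.le, hs.2.trans ht.2⟩
      exact hF.bd _ _ _ (hgM z s) ha.1 ha.2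
    rw [sub_zero, abs_of_nonneg ht.1] at h1
    have h2 := mul_le_mul_of_nonneg_left ht.2 hF.Kpos.le
    have := norm_add_le x₀ (∫ s in (0:ℝ)..t, F (g z s) (u1 s) (u2 s))
    linarith
  refine ⟨Set.IccExtend hT z, (z.continuous.Icc_extend').continuousOn, fun t ht => ?_⟩
  rw [hzt t ht]
  congr 1
  refine intervalIntegral.integral_congr fun s hs => ?_
  rw [Set.uIcc_of_le ht.1] at hs
  simp only [g, tbClamp_eq _ (hzM s ⟨hs.1, hs.2.trans ht.2⟩)]

lemma tb_sup {T c : ℝ} {f : ℝ → Fin 5 → ℝ} (hf : ContinuousOn f (Set.Icc 0 T))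
    (h : ∀ B, (∀ s ∈ Set.Icc 0 T, ‖f s‖ ≤ B) → ∀ t ∈ Set.Icc 0 T, ‖f t‖ ≤ B / 2 + c) :
    ∀ t ∈ Set.Icc 0 T, ‖f t‖ ≤ 2 * c := by
  intro t ht
  obtain ⟨r, hr, hmax⟩ := isCompact_Icc.exists_isMaxOn ⟨t, ht⟩ hf.norm
  have h1 := h ‖f r‖ (fun s hs => hmax hs) r hr
  have h2 : ‖f t‖ ≤ ‖f r‖ := hmax ht
  linarith

lemma tb_gint {T : ℝ} {u1 u2 v1 v2 : ℝ → ℝ} (hu : IsAdmissible T u1 u2)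
    (hv : IsAdmissible T v1 v2) (P : ℝ × ℝ × ℝ × ℝ → ℝ) (hP : Continuous P) :
    IntegrableOn (fun s => P (u1 s, u2 s, v1 s, v2 s)) (Set.Icc 0 T) volume := by
  obtain ⟨a1, a2, a3⟩ := hu
  obtain ⟨b1, b2, b3⟩ := hv
  have hK : IsCompact (Set.Icc (0:ℝ) 1 ×ˢ Set.Icc (0:ℝ) 1 ×ˢ Set.Icc (0:ℝ) 1 ×ˢ Set.Icc (0:ℝ) 1) :=
    isCompact_Icc.prod (isCompact_Icc.prod (isCompact_Icc.prod isCompact_Icc))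
  obtain ⟨C, hC⟩ := hK.exists_bound_of_continuousOn hP.continuousOn
  have : IsFiniteMeasure (volume.restrict (Set.Icc (0:ℝ) T)) := ⟨by simp⟩
  refine Integrable.of_bound (C := C) ?_ ?_
  · exact (hP.measurable.comp (a1.prodMk (a2.prodMk (b1.prodMk b2)))).aestronglyMeasurable
  · refine (ae_restrict_iff' measurableSet_Icc).2 (Filter.Eventually.of_forall fun s hs => ?_)
    exact hC _ ⟨(a3 s hs).1, (a3 s hs).2, (b3 s hs).1, (b3 s hs).2⟩

lemma tb_est {F : (Fin 5 → ℝ) → ℝ → ℝ → (Fin 5 → ℝ)} {K T : ℝ} {x₀ : Fin 5 → ℝ}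
    (hF : TBGood F (‖x₀‖ + 1) K) (hT : 0 ≤ T) (hT1 : T ≤ 1) (hKT : K * T ≤ 1/2)
    {u1 u2 v1 v2 : ℝ → ℝ} {x y z : ℝ → Fin 5 → ℝ} (hu : IsAdmissible T u1 u2)
    (hv : IsAdmissible T v1 v2)
    (hw : IsAdmissible T (fun t => (u1 t + v1 t)/2) (fun t => (u2 t + v2 t)/2))
    (hx : TBTraj F T x₀ u1 u2 x) (hy : TBTraj F T x₀ v1 v2 y)
    (hz : TBTraj F T x₀ (fun t => (u1 t + v1 t)/2) (fun t => (u2 t + v2 t)/2) z)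
    {G : ℝ} (hG : G = ∫ s in (0:ℝ)..T, (|u1 s - v1 s| + |u2 s - v2 s|)) :
    (∀ t ∈ Set.Icc 0 T, ‖x t - y t‖ ≤ 2 * (K * G)) ∧
    ∀ t ∈ Set.Icc 0 T, ‖z t - (1/2:ℝ) • (x t + y t)‖ ≤ 2 * ((4 * K^3 + 2 * K^2) * G^2) := by
  have hxM := tb_apriori hF hKT hu hx
  have hyM := tb_apriori hF hKT hv hy
  have hzM := tb_apriori hF hKT hw hz
  have hxi := tb_integrable hF hu hx.1 hxM
  have hyi := tb_integrable hF hv hy.1 hyM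
  have hzi := tb_integrable hF hw hz.1 hzM
  have hK := hF.Kpos
  have hgI := tb_gint hu hv (fun p => |p.1 - p.2.2.1| + |p.2.1 - p.2.2.2|) (by fun_prop)
  simp only at hgI
  have hgt : ∀ t ∈ Set.Icc 0 T,
      IntervalIntegrable (fun s => |u1 s - v1 s| + |u2 s - v2 s|) volume 0 t := by
    intro t ht
    rw [intervalIntegrable_iff_integrableOn_Icc_of_le ht.1]
    exact hgI.mono_set (Set.Icc_subset_Icc_right ht.2)
  have hgG : ∀ t ∈ Set.Icc 0 T, ∫ s in (0:ℝ)..t, (|u1 s - v1 s| + |u2 s - v2 s|) ≤ G := by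
    intro t ht
    rw [hG]
    refine intervalIntegral.integral_mono_interval le_rfl ht.1 ht.2 ?_ (hgt T ⟨hT, le_rfl⟩)
    exact Filter.Eventually.of_forall fun s => by positivity
  have hG0 : 0 ≤ G := by
    rw [hG]; exact intervalIntegral.integral_nonneg hT fun s _ => by positivity
  -- generic integral bound
  have hbound : ∀ (f : ℝ → Fin 5 → ℝ) (a b : ℝ), 0 ≤ a → 0 ≤ b → ∀ t ∈ Set.Icc 0 T,
      (∀ s ∈ Set.Icc 0 T, ‖f s‖ ≤ a + b * (|u1 s - v1 s| + |u2 s - v2 s|)) →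
      ‖∫ s in (0:ℝ)..t, f s‖ ≤ a * T + b * G := by
    intro f a b ha hb t ht hf
    have h1 : ‖∫ s in (0:ℝ)..t, f s‖ ≤
        ∫ s in (0:ℝ)..t, (a + b * (|u1 s - v1 s| + |u2 s - v2 s|)) := by
      refine intervalIntegral.norm_integral_le_of_norm_le ht.1 ?_
        (intervalIntegrable_const.add ((hgt t ht).const_mul b))
      exact Filter.Eventually.of_forall fun s hs => hf s ⟨hs.1.le, hs.2.trans ht.2⟩
    rw [intervalIntegral.integral_add intervalIntegrable_const ((hgt t ht).const_mul b),
      intervalIntegral.integral_const_mul, intervalIntegral.integral_const, smul_eq_mul,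
      sub_zero] at h1
    have h2 := mul_le_mul_of_nonneg_left (hgG t ht) hb
    have h3 := mul_le_mul_of_nonneg_left ht.2 ha
    linarith
  have hD : ∀ t ∈ Set.Icc 0 T, ‖x t - y t‖ ≤ 2 * (K * G) := by
    refine tb_sup (f := fun t => x t - y t) (hx.1.sub hy.1) ?_
    intro B hB t ht
    have hB0 : 0 ≤ B := (norm_nonneg _).trans (hB t ht)
    rw [hx.2 t ht, hy.2 t ht, add_sub_add_left_eq_sub,
      ← intervalIntegral.integral_sub (hxi t ht) (hyi t ht)]
    have := hbound (fun s => F (x s) (u1 s) (u2 s) - F (y s) (v1 s) (v2 s)) (K * B) K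
      (by positivity) hK.le t ht (by
        intro s hs
        have a := hu.2.2 s hs
        have b := hv.2.2 s hs
        refine (hF.lip _ _ _ _ _ _ (hxM s hs) (hyM s hs) a.1 a.2 b.1 b.2).trans ?_
        rw [← mul_add]
        exact mul_le_mul_of_nonneg_left (add_le_add_left (hB s hs) _) hK.le)
    have h4 := mul_le_mul_of_nonneg_right hKT hB0
    linarith
  refine ⟨hD, ?_⟩
  refine tb_sup (f := fun t => z t - (1/2:ℝ) • (x t + y t))
    (by have h1 := hx.1; have h2 := hy.1; have h3 := hz.1; fun_prop) ?_
  intro B hB t ht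
  have hB0 : 0 ≤ B := (norm_nonneg _).trans (hB t ht)
  have e : z t - (1/2:ℝ) • (x t + y t) = ∫ s in (0:ℝ)..t,
      (F (z s) ((u1 s + v1 s)/2) ((u2 s + v2 s)/2)
        - (1/2:ℝ) • (F (x s) (u1 s) (u2 s) + F (y s) (v1 s) (v2 s))) := by
    have hsm : IntervalIntegrable (fun s => (1/2:ℝ) • (F (x s) (u1 s) (u2 s)
        + F (y s) (v1 s) (v2 s))) volume 0 t := ((hxi t ht).add (hyi t ht)).smul (1/2:ℝ)
    rw [intervalIntegral.integral_sub (hzi t ht) hsm,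
      intervalIntegral.integral_smul, intervalIntegral.integral_add (hxi t ht) (hyi t ht)]
    have h1 := hz.2 t ht
    have h2 := hx.2 t ht
    have h3 := hy.2 t ht
    simp only at h1
    rw [h1, h2, h3]
    module
  rw [e]
  have := hbound (fun s => F (z s) ((u1 s + v1 s)/2) ((u2 s + v2 s)/2)
        - (1/2:ℝ) • (F (x s) (u1 s) (u2 s) + F (y s) (v1 s) (v2 s)))
      (K * B + K * (2 * (K * G)) * (2 * (K * G))) (K * (2 * (K * G)))
      (by positivity) (by positivity) t ht (by
        intro s hs
        have a := hu.2.2 s hs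
        have b := hv.2.2 s hs
        have c := hw.2.2 s hs
        have hmM : ‖(1/2:ℝ) • (x s + y s)‖ ≤ ‖x₀‖ + 1 := by
          rw [norm_smul]
          have := norm_add_le (x s) (y s)
          have := hxM s hs
          have := hyM s hs
          norm_num
          linarith
        have l1 := hF.lip _ _ _ _ _ _ (hzM s hs) hmM c.1 c.2 c.1 c.2
        have l2 := hF.mid (x s) (y s) (u1 s) (u2 s) (v1 s) (v2 s)
        simp only [sub_self, abs_zero, add_zero] at l1
        have l3 := mul_le_mul_of_nonneg_left (hB s hs) hK.le
        have l4 : K * ‖x s - y s‖ * (‖x s - y s‖ + (|u1 s - v1 s| + |u2 s - v2 s|)) ≤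
            K * (2 * (K * G)) * (2 * (K * G) + (|u1 s - v1 s| + |u2 s - v2 s|)) := by
          have := hD s hs
          gcongr
        have l5 := norm_sub_le_norm_sub_add_norm_sub (F (z s) ((u1 s + v1 s)/2) ((u2 s + v2 s)/2))
          (F ((1/2:ℝ) • (x s + y s)) ((u1 s + v1 s)/2) ((u2 s + v2 s)/2))
          ((1/2:ℝ) • (F (x s) (u1 s) (u2 s) + F (y s) (v1 s) (v2 s)))
        linarith)
  refine this.trans ?_
  have h4 := mul_le_mul_of_nonneg_right hKT hB0
  have h5 : K * (2 * (K * G)) * (2 * (K * G)) * T ≤ K * (2 * (K * G)) * (2 * (K * G)) :=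
    mul_le_of_le_one_right (by positivity) hT1
  nlinarith

lemma tb_unique {F : (Fin 5 → ℝ) → ℝ → ℝ → (Fin 5 → ℝ)} {K T W1 W2 : ℝ} {x₀ : Fin 5 → ℝ}
    (hF : TBGood F (‖x₀‖ + 1) K) (hT : 0 < T) (hT1 : T ≤ 1) (hKT : K * T ≤ 1/2)
    (hs1 : 64 * (4 * K^3 + 2 * K^2) * T < W1) (hs2 : 64 * (4 * K^3 + 2 * K^2) * T < W2)
    {u1 u2 v1 v2 : ℝ → ℝ} {x y : ℝ → Fin 5 → ℝ} (hu : IsAdmissible T u1 u2)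
    (hv : IsAdmissible T v1 v2)
    (hx : TBTraj F T x₀ u1 u2 x) (hy : TBTraj F T x₀ v1 v2 y)
    (hou : ∀ (w1 w2 : ℝ → ℝ) (z : ℝ → Fin 5 → ℝ), IsAdmissible T w1 w2 → TBTraj F T x₀ w1 w2 z →
      tbCost W1 W2 T u1 u2 x ≤ tbCost W1 W2 T w1 w2 z)
    (hov : ∀ (w1 w2 : ℝ → ℝ) (z : ℝ → Fin 5 → ℝ), IsAdmissible T w1 w2 → TBTraj F T x₀ w1 w2 z →
      tbCost W1 W2 T v1 v2 y ≤ tbCost W1 W2 T w1 w2 z) :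
    (∀ᵐ t ∂(volume.restrict (Set.Icc (0 : ℝ) T)), u1 t = v1 t ∧ u2 t = v2 t) ∧
        ∀ t ∈ Set.Icc (0 : ℝ) T, x t = y t := by
  have hK := hF.Kpos
  have hw : IsAdmissible T (fun t => (u1 t + v1 t)/2) (fun t => (u2 t + v2 t)/2) := by
    refine ⟨(hu.1.add hv.1).div_const _, (hu.2.1.add hv.2.1).div_const _, fun t ht => ?_⟩
    obtain ⟨⟨a, b⟩, c, d⟩ := hu.2.2 t ht
    obtain ⟨⟨a', b'⟩, c', d'⟩ := hv.2.2 t ht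
    refine ⟨⟨?_, ?_⟩, ?_, ?_⟩ <;> simp only <;> linarith
  obtain ⟨z, hz⟩ := tb_exists_s9 hF hT.le hKT hw
  obtain ⟨hD, hE⟩ := tb_est hF hT.le hT1 hKT hu hv hw hx hy hz rfl
  set G := ∫ s in (0:ℝ)..T, (|u1 s - v1 s| + |u2 s - v2 s|) with hG
  set C := 2 * (4 * K^3 + 2 * K^2) with hC
  have hCp : 0 < C := by positivity
  have hint : ∀ P : ℝ × ℝ × ℝ × ℝ → ℝ, Continuous P →
      IntervalIntegrable (fun s => P (u1 s, u2 s, v1 s, v2 s)) volume 0 T := fun P hP =>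
    (intervalIntegrable_iff_integrableOn_Icc_of_le hT.le).2 (tb_gint hu hv P hP)
  have hg1 : IntervalIntegrable (fun s => |u1 s - v1 s| + |u2 s - v2 s|) volume 0 T :=
    hint (fun p => |p.1 - p.2.2.1| + |p.2.1 - p.2.2.2|) (by fun_prop)
  have hh1 : IntervalIntegrable (fun s => (u1 s - v1 s)^2) volume 0 T :=
    hint (fun p => (p.1 - p.2.2.1)^2) (by fun_prop)
  have hh2 : IntervalIntegrable (fun s => (u2 s - v2 s)^2) volume 0 T :=
    hint (fun p => (p.2.1 - p.2.2.2)^2) (by fun_prop)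
  set H1 := ∫ s in (0:ℝ)..T, (u1 s - v1 s)^2 with hH1
  set H2 := ∫ s in (0:ℝ)..T, (u2 s - v2 s)^2 with hH2
  have hH10 : 0 ≤ H1 := intervalIntegral.integral_nonneg hT.le fun s _ => by positivity
  have hH20 : 0 ≤ H2 := intervalIntegral.integral_nonneg hT.le fun s _ => by positivity
  -- Cauchy-Schwarz
  have hCS : G^2 ≤ 2 * T * (H1 + H2) := by
    have h0 : ∫ s in (0:ℝ)..T, (2 * G / T * (|u1 s - v1 s| + |u2 s - v2 s|) - (G/T)^2) ≤
        ∫ s in (0:ℝ)..T, (2 * (u1 s - v1 s)^2 + 2 * (u2 s - v2 s)^2) := by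
      refine intervalIntegral.integral_mono_on hT.le ((hg1.const_mul _).sub intervalIntegrable_const)
        ((hh1.const_mul _).add (hh2.const_mul _)) fun s _ => ?_
      have e1 := sq_abs (u1 s - v1 s)
      have e2 := sq_abs (u2 s - v2 s)
      have e3 := sq_nonneg (|u1 s - v1 s| + |u2 s - v2 s| - G/T)
      have e4 := sq_nonneg (|u1 s - v1 s| - |u2 s - v2 s|)
      rw [mul_div_assoc]
      nlinarith
    rw [intervalIntegral.integral_sub (hg1.const_mul _) intervalIntegrable_const,
      intervalIntegral.integral_add (hh1.const_mul _) (hh2.const_mul _),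
      intervalIntegral.integral_const_mul, intervalIntegral.integral_const_mul,
      intervalIntegral.integral_const_mul, intervalIntegral.integral_const, ← hG, ← hH1, ← hH2,
      smul_eq_mul, sub_zero] at h0
    have e : 2 * G / T * G - T * (G/T)^2 = G^2 / T := by field_simp; ring
    rw [e, div_le_iff₀ hT] at h0
    linarith
  have ci : ∀ {f : ℝ → Fin 5 → ℝ}, ContinuousOn f (Set.Icc 0 T) → ∀ i,
      IntervalIntegrable (fun s => f s i) volume 0 T := by
    intro f hf i
    refine ContinuousOn.intervalIntegrable ?_
    rw [Set.uIcc_of_le hT.le]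
    exact (continuous_apply i).comp_continuousOn hf
  have hcx := (((ci hx.1 2).add (ci hx.1 3)).add (hint (fun p => W1/2 * p.1^2) (by fun_prop))).add
    (hint (fun p => W2/2 * p.2.1^2) (by fun_prop))
  have hcy := (((ci hy.1 2).add (ci hy.1 3)).add
    (hint (fun p => W1/2 * p.2.2.1^2) (by fun_prop))).add
    (hint (fun p => W2/2 * p.2.2.2^2) (by fun_prop))
  have hcz := (((ci hz.1 2).add (ci hz.1 3)).add
    (hint (fun p => W1/2 * ((p.1 + p.2.2.1)/2)^2) (by fun_prop))).add
    (hint (fun p => W2/2 * ((p.2.1 + p.2.2.2)/2)^2) (by fun_prop))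
  have hmain : tbCost W1 W2 T (fun t => (u1 t + v1 t)/2) (fun t => (u2 t + v2 t)/2) z ≤
      ((1/2) * tbCost W1 W2 T u1 u2 x + (1/2) * tbCost W1 W2 T v1 v2 y)
        + ((2 * (C * G^2)) * T - (W1/8 * H1 + W2/8 * H2)) := by
    have hR : ((1/2) * tbCost W1 W2 T u1 u2 x + (1/2) * tbCost W1 W2 T v1 v2 y)
        + ((2 * (C * G^2)) * T - (W1/8 * H1 + W2/8 * H2)) =
        ∫ t in (0:ℝ)..T, (((1/2) * (x t 2 + x t 3 + W1 / 2 * u1 t ^ 2 + W2 / 2 * u2 t ^ 2)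
          + (1/2) * (y t 2 + y t 3 + W1 / 2 * v1 t ^ 2 + W2 / 2 * v2 t ^ 2))
          + ((2 * (C * G^2)) - (W1/8 * (u1 t - v1 t)^2 + W2/8 * (u2 t - v2 t)^2))) := by
      rw [intervalIntegral.integral_add ((hcx.const_mul _).add (hcy.const_mul _))
        (intervalIntegrable_const.sub ((hh1.const_mul _).add (hh2.const_mul _))),
        intervalIntegral.integral_add (hcx.const_mul _) (hcy.const_mul _),
        intervalIntegral.integral_sub intervalIntegrable_const
          ((hh1.const_mul _).add (hh2.const_mul _)),
        intervalIntegral.integral_add (hh1.const_mul _) (hh2.const_mul _),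
        intervalIntegral.integral_const_mul (1/2), intervalIntegral.integral_const_mul (1/2),
        intervalIntegral.integral_const_mul (W1/8), intervalIntegral.integral_const_mul (W2/8),
        intervalIntegral.integral_const, ← hH1, ← hH2, smul_eq_mul, sub_zero]
      simp only [tbCost]
      ring
    rw [hR]
    refine intervalIntegral.integral_mono_on hT.le hcz
      (((hcx.const_mul _).add (hcy.const_mul _)).add
        (intervalIntegrable_const.sub ((hh1.const_mul _).add (hh2.const_mul _)))) fun t ht => ?_
    have b : ∀ i, z t i - (1/2) * (x t i + y t i) ≤ C * G^2 := by
      intro i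
      have h1 := (norm_le_pi_norm (z t - (1/2:ℝ) • (x t + y t)) i).trans (hE t ht)
      rw [Real.norm_eq_abs] at h1
      have h2 := (le_abs_self _).trans h1
      simp only [Pi.sub_apply, Pi.smul_apply, Pi.add_apply, smul_eq_mul] at h2
      rw [hC]; linarith
    have b2 := b 2
    have b3 := b 3
    simp only
    nlinarith
  have o1 := hou _ _ z hw hz
  have o2 := hov _ _ z hw hz
  have hfin : 2 * (C * G^2) * T - (W1/8 * H1 + W2/8 * H2) ≥ 0 := by linarith
  have hCT : 2 * (C * G^2) * T ≤ 4 * C * T * (H1 + H2) := by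
    have h1 : G^2 ≤ 2 * (H1 + H2) := hCS.trans (by nlinarith)
    have := mul_le_mul_of_nonneg_left h1 (show 0 ≤ 2 * C * T by positivity)
    linarith
  have k1 : 32 * C * T < W1 := by rw [hC]; linarith
  have k2 : 32 * C * T < W2 := by rw [hC]; linarith
  have z1 : H1 = 0 := by nlinarith
  have z2 : H2 = 0 := by nlinarith
  have zG : G = 0 := by
    rw [z1, z2] at hCS
    have : G^2 ≤ 0 := by linarith
    exact pow_eq_zero_iff (two_ne_zero) |>.1 (le_antisymm this (sq_nonneg _))
  constructor
  · rw [← restrict_Ioc_eq_restrict_Icc]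
    have a1 := (intervalIntegral.integral_eq_zero_iff_of_le_of_nonneg_ae hT.le
      (Filter.Eventually.of_forall fun s => by simp only [Pi.zero_apply]; positivity) hh1).1 z1
    have a2 := (intervalIntegral.integral_eq_zero_iff_of_le_of_nonneg_ae hT.le
      (Filter.Eventually.of_forall fun s => by simp only [Pi.zero_apply]; positivity) hh2).1 z2
    filter_upwards [a1, a2] with s h1 h2
    simp only [Pi.zero_apply] at h1 h2
    exact ⟨sub_eq_zero.1 (pow_eq_zero_iff two_ne_zero |>.1 h1),
      sub_eq_zero.1 (pow_eq_zero_iff two_ne_zero |>.1 h2)⟩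
  · intro t ht
    have := hD t ht
    rw [zG] at this
    have h0 : ‖x t - y t‖ ≤ 0 := by linarith
    exact sub_eq_zero.1 (norm_le_zero_iff.1 h0)

lemma tb_good (μ β δ ω ωR σ σR τ0 τ1 τ2 N ε1 ε2 φ M : ℝ) :
    ∃ K, TBGood (tbRHS μ β δ ω ωR σ σR τ0 τ1 τ2 N ε1 ε2 φ) M K := by
  set F := tbRHS μ β δ ω ωR σ σR τ0 τ1 τ2 N ε1 ε2 φ with hFdef
  have hsm : ContDiff ℝ 1 fun p : (Fin 5 → ℝ) × ℝ × ℝ => F p.1 p.2.1 p.2.2 := by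
    rw [contDiff_pi]
    intro i
    have hc : ∀ j : Fin 5, ContDiff ℝ 1 fun p : (Fin 5 → ℝ) × ℝ × ℝ => p.1 j := fun j =>
      (contDiff_apply ℝ ℝ j).comp contDiff_fst
    have h0 := hc 0
    have h1 := hc 1
    have h2 := hc 2
    have h3 := hc 3
    have h4 := hc 4
    fin_cases i <;> simp [hFdef, tbRHS] <;> fun_prop
  have hcomp : IsCompact (Metric.closedBall (0 : Fin 5 → ℝ) M ×ˢ
      (Set.Icc (0:ℝ) 1 ×ˢ Set.Icc (0:ℝ) 1)) :=
    (isCompact_closedBall _ _).prod (isCompact_Icc.prod isCompact_Icc)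
  obtain ⟨K1, hK1⟩ := hcomp.exists_bound_of_continuousOn hsm.continuous.continuousOn
  obtain ⟨K2, hK2⟩ := LocallyLipschitzOn.exists_lipschitzOnWith_of_compact hcomp
    (hsm.locallyLipschitz.locallyLipschitzOn)
  set K3 := |β/N| * (1 + |σ| + |σR|) + |ε1| + |ε2| with hK3
  have hK30 : 0 ≤ K3 := by positivity
  set K := |K1| + K2 + K3 + 1 with hK
  have hK2' : (0:ℝ) ≤ K2 := K2.2
  refine ⟨K, hsm.continuous, by positivity, ?_, ?_, ?_⟩
  · intro x a b hx ha hb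
    have := hK1 (x, a, b) ⟨by simpa using hx, ha, hb⟩
    simp only at this
    have := le_abs_self K1
    linarith
  · intro x y a b c d hx hy ha hb hc hd
    have h := hK2.dist_le_mul (x, a, b) ⟨by simpa using hx, ha, hb⟩ (y, c, d)
      ⟨by simpa using hy, hc, hd⟩
    rw [dist_eq_norm] at h
    have h2 : dist (x, a, b) (y, c, d) ≤ ‖x - y‖ + (|a - c| + |b - d|) := by
      rw [Prod.dist_eq, Prod.dist_eq, dist_eq_norm, Real.dist_eq, Real.dist_eq]
      simp only
      have := norm_nonneg (x - y)
      have := abs_nonneg (a - c)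
      have := abs_nonneg (b - d)
      refine max_le (by linarith) (max_le (by linarith) (by linarith))
    refine h.trans (mul_le_mul ?_ h2 dist_nonneg (by positivity))
    have := abs_nonneg K1
    linarith
  · intro x y a b c d
    have hX : ∀ i, |x i - y i| ≤ ‖x - y‖ := fun i => norm_le_pi_norm (x - y) i
    set X := ‖x - y‖ with hXd
    have hX0 : 0 ≤ X := norm_nonneg _
    set A := |a - c| with hA
    set B := |b - d| with hB
    have hA0 : 0 ≤ A := abs_nonneg _
    have hB0 : 0 ≤ B := abs_nonneg _
    have hXX : ∀ i j, |(x i - y i) * (x j - y j)| ≤ X * (X + (A + B)) := by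
      intro i j
      rw [abs_mul]
      exact mul_le_mul (hX i) ((hX j).trans (by linarith)) (abs_nonneg _) hX0
    have hXA : ∀ i, |(a - c) * (x i - y i)| ≤ X * (X + (A + B)) := by
      intro i
      rw [abs_mul, mul_comm]
      exact mul_le_mul (hX i) (by linarith) (abs_nonneg _) hX0
    have hXB : ∀ i, |(b - d) * (x i - y i)| ≤ X * (X + (A + B)) := by
      intro i
      rw [abs_mul, mul_comm]
      exact mul_le_mul (hX i) (by linarith) (abs_nonneg _) hX0
    set Y := X * (X + (A + B)) with hY
    have hY0 : 0 ≤ Y := by positivity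
    have hKY : K3 * Y ≤ K * X * (X + (A + B)) := by
      rw [mul_assoc, ← hY]
      refine mul_le_mul_of_nonneg_right ?_ hY0
      have := abs_nonneg K1
      linarith
    refine (pi_norm_le_iff_of_nonneg (by positivity)).2 fun i => ?_
    refine le_trans ?_ hKY
    rw [Real.norm_eq_abs]
    have m : ∀ (k q : ℝ), |q| ≤ Y → |k * q| ≤ |k| * Y := fun k q hq => by
      rw [abs_mul]; exact mul_le_mul_of_nonneg_left hq (abs_nonneg _)
    have p1 : 0 ≤ |β/N| * Y := by positivity
    have p2 : 0 ≤ |β/N * σ| * Y := by positivity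
    have p3 : 0 ≤ |β/N * σR| * Y := by positivity
    have p4 : 0 ≤ |ε1| * Y := by positivity
    have p5 : 0 ≤ |ε2| * Y := by positivity
    have q1 := abs_le.1 (m (β/N) _ (hXX 2 0))
    have q2 := abs_le.1 (m (β/N * σ) _ (hXX 2 3))
    have q3 := abs_le.1 (m (β/N * σR) _ (hXX 2 4))
    have q4 := abs_le.1 (m ε1 _ (hXA 2))
    have q5 := abs_le.1 (m ε2 _ (hXB 3))
    have hsum : K3 * Y = |β/N| * Y + |β/N * σ| * Y + |β/N * σR| * Y + |ε1| * Y + |ε2| * Y := by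
      rw [hK3, abs_mul, abs_mul]; ring
    rw [hsum]
    clear_value K
    clear hsm hcomp hK1 hK2 hsum hK3 hK hKY
    generalize |β/N| * Y = Z1 at *
    generalize |β/N * σ| * Y = Z2 at *
    generalize |β/N * σR| * Y = Z3 at *
    generalize |ε1| * Y = Z4 at *
    generalize |ε2| * Y = Z5 at *
    obtain ⟨q1, q1'⟩ := q1
    obtain ⟨q2, q2'⟩ := q2
    obtain ⟨q3, q3'⟩ := q3
    obtain ⟨q4, q4'⟩ := q4
    obtain ⟨q5, q5'⟩ := q5
    clear m hXX hXA hXB hX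
    fin_cases i <;> simp [hFdef, tbRHS] <;> rw [abs_le] <;> constructor <;> linarith

end TBAux

open MeasureTheory in
/-- For sufficiently small final time, the optimal control
pair of the TB optimal control problem is unique: any two minimizing admissible
control pairs coincide almost everywhere on `[0,T]` and their associated state
trajectories coincide on `[0,T]`. -/
theorem tb_optimal_control_unique_small_time
    (μ β δ ω ωR σ σR τ0 τ1 τ2 N ε1 ε2 φ W1 W2 : ℝ)
    (hμ : 0 < μ) (hβ : 0 < β) (hδ : 0 < δ) (hω : 0 < ω) (hωR : 0 < ωR)
    (hσ : 0 < σ) (hσR : 0 < σR) (hτ0 : 0 < τ0) (hτ1 : 0 < τ1) (hτ2 : 0 < τ2)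
    (hN : 0 < N) (hε1 : 0 < ε1) (hε2 : 0 < ε2) (hφ : φ ∈ Set.Ioo (0 : ℝ) 1)
    (hW1 : 0 < W1) (hW2 : 0 < W2)
    (x₀ : Fin 5 → ℝ) (hx₀ : ∀ i, 0 ≤ x₀ i)
    (hx₀sum : x₀ 0 + x₀ 1 + x₀ 2 + x₀ 3 + x₀ 4 = N) :
    ∃ T₀ > (0 : ℝ), ∀ T : ℝ, 0 < T → T ≤ T₀ →
      ∀ (u1 u2 : ℝ → ℝ) (x : ℝ → Fin 5 → ℝ) (v1 v2 : ℝ → ℝ) (y : ℝ → Fin 5 → ℝ),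
        IsAdmissible T u1 u2 →
        IsTrajectory μ β δ ω ωR σ σR τ0 τ1 τ2 N ε1 ε2 φ T x₀ u1 u2 x →
        IsAdmissible T v1 v2 →
        IsTrajectory μ β δ ω ωR σ σR τ0 τ1 τ2 N ε1 ε2 φ T x₀ v1 v2 y →
        (∀ (w1 w2 : ℝ → ℝ) (z : ℝ → Fin 5 → ℝ),
          IsAdmissible T w1 w2 →
          IsTrajectory μ β δ ω ωR σ σR τ0 τ1 τ2 N ε1 ε2 φ T x₀ w1 w2 z →
          tbCost W1 W2 T u1 u2 x ≤ tbCost W1 W2 T w1 w2 z) →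
        (∀ (w1 w2 : ℝ → ℝ) (z : ℝ → Fin 5 → ℝ),
          IsAdmissible T w1 w2 →
          IsTrajectory μ β δ ω ωR σ σR τ0 τ1 τ2 N ε1 ε2 φ T x₀ w1 w2 z →
          tbCost W1 W2 T v1 v2 y ≤ tbCost W1 W2 T w1 w2 z) →
        (∀ᵐ t ∂(volume.restrict (Set.Icc (0 : ℝ) T)),
          u1 t = v1 t ∧ u2 t = v2 t) ∧
        ∀ t ∈ Set.Icc (0 : ℝ) T, x t = y t := by

  obtain ⟨K, hF⟩ := tb_good μ β δ ω ωR σ σR τ0 τ1 τ2 N ε1 ε2 φ (‖x₀‖ + 1)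
  have hK := hF.Kpos
  have hQ : 0 < 64 * (4 * K^3 + 2 * K^2) := by positivity
  set Q := 64 * (4 * K^3 + 2 * K^2) with hQd
  refine ⟨min 1 (min (1 / (2 * K)) (min (W1 / (2 * Q)) (W2 / (2 * Q)))), by positivity, ?_⟩
  intro T hT hTle u1 u2 x v1 v2 y hu hx hv hy hou hov
  rw [le_min_iff, le_min_iff, le_min_iff, le_div_iff₀ (by positivity), le_div_iff₀ (by positivity),
    le_div_iff₀ (by positivity)] at hTle
  obtain ⟨t1, t2, t3, t4⟩ := hTle
  exact tb_unique hF hT t1 (by linarith) (by rw [← hQd]; nlinarith) (by rw [← hQd]; nlinarith)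
    hu hv hx hy hou hov
end
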